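/- arXiv:1008.4812 — 2 statements merged into one kernel-verified Lean document; each statement's English description precedes it below -/
import Mathlib

section
/- For every integer m ≥ 1 and every integer k ≥ 0 there is a constant C (depending on m, k and μ) such that for all N with m ∣ N, |E[Tr(A(x)^{2k+1})]| ≤ C · N^{k+1}; equivalently, the normalized odd moment N^{−(k+3/2)} · E[Tr(A(x)^{2k+1})] is O(N^{−1/2}) and in particular tends to 0 as N → ∞ over multiples of m. -/
open MeasureTheory Filter

/-- The index set `S(m,N)`: the quotient of `ZMod N × ZMod m` identifying each point
`(d, r)` with its image `(-d, r + ι d)` under the involution `τ`. -/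
def BCidx (m N : ℕ) (hm : m ∣ N) : Type :=
  Quot (fun a b : ZMod N × ZMod m => b = (-a.1, a.2 + ZMod.castHom hm (ZMod m) a.1))

/-- The symmetric `m`-block circulant matrix attached to `x : S(m,N) → ℝ`. -/
def BCmat (m N : ℕ) (hm : m ∣ N) (x : BCidx m N hm → ℝ) : Matrix (Fin N) (Fin N) ℝ :=
  fun i j => x (Quot.mk _ (((j : ℕ) : ZMod N) - ((i : ℕ) : ZMod N),
    ZMod.castHom hm (ZMod m) ((i : ℕ) : ZMod N)))

/-- `E[Tr (A(x)^e)]` for the i.i.d. product measure with marginal `μ`. -/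
noncomputable def expTrace (μ : MeasureTheory.Measure ℝ) (m N e : ℕ) (hm : m ∣ N) (hN : N ≠ 0) : ℝ :=
  haveI : NeZero N := ⟨hN⟩
  haveI : NeZero m := ⟨by rintro rfl; exact hN (zero_dvd_iff.mp hm)⟩
  haveI : Finite (BCidx m N hm) := Finite.of_surjective _ (fun q => Quot.exists_rep q)
  haveI : Fintype (BCidx m N hm) := Fintype.ofFinite _
  ∫ x : BCidx m N hm → ℝ, Matrix.trace ((BCmat m N hm x) ^ e) ∂(MeasureTheory.Measure.pi fun _ => μ)

section helpers

/-- The word of matrix-entry variables along the walk from `i` with increments `d`. -/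
def bcWord (m N : ℕ) (hm : m ∣ N) :
    (n : ℕ) → ZMod N → (Fin n → ZMod N) → Fin n → BCidx m N hm
  | 0, _, _ => fun t => t.elim0
  | n + 1, i, d => Fin.cons (Quot.mk _ (d 0, ZMod.castHom hm (ZMod m) i))
      (bcWord m N hm n (i + d 0) (Fin.tail d))

lemma bcWord_cons_zero (m N : ℕ) (hm : m ∣ N) (n : ℕ) (i : ZMod N) (d : Fin (n + 1) → ZMod N) :
    bcWord m N hm (n + 1) i d 0 = Quot.mk _ (d 0, ZMod.castHom hm (ZMod m) i) := rfl

lemma bcWord_cons_succ (m N : ℕ) (hm : m ∣ N) (n : ℕ) (i : ZMod N) (d : Fin (n + 1) → ZMod N)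
    (t : Fin n) :
    bcWord m N hm (n + 1) i d t.succ = bcWord m N hm n (i + d 0) (Fin.tail d) t := rfl

lemma bcWord_fst (m N : ℕ) (hm : m ∣ N) (n : ℕ) : ∀ (i : ZMod N) (d : Fin n → ZMod N) (t : Fin n),
    ∃ r : ZMod m, bcWord m N hm n i d t = Quot.mk _ (d t, r) := by
  induction n with
  | zero => intro i d t; exact t.elim0
  | succ n ih =>
    intro i d t
    refine Fin.cases ?_ (fun t => ?_) t
    · exact ⟨_, rfl⟩
    · obtain ⟨r, hr⟩ := ih (i + d 0) (Fin.tail d) t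
      exact ⟨r, hr⟩

lemma bc_quot (m N : ℕ) (hm : m ∣ N) (a b : ZMod N × ZMod m)
    (h : (Quot.mk _ a : BCidx m N hm) = Quot.mk _ b) : a.1 = b.1 ∨ a.1 = -b.1 := by
  let F : BCidx m N hm → Set (ZMod N) := Quot.lift (fun a => {z | z = a.1 ∨ z = -a.1}) (by
    rintro a b rfl
    ext z
    simp only [Set.mem_ofPred_eq, neg_neg]
    tauto)
  have h2 : F (Quot.mk _ a) = F (Quot.mk _ b) := congrArg F h
  have h3 : a.1 ∈ F (Quot.mk _ a) := Or.inl rfl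
  rw [h2] at h3
  exact h3

/-- The matrix indexed by `ZMod N`. -/
def bcMatZ (m N : ℕ) (hm : m ∣ N) (x : BCidx m N hm → ℝ) : Matrix (ZMod N) (ZMod N) ℝ :=
  fun i j => x (Quot.mk _ (j - i, ZMod.castHom hm (ZMod m) i))

lemma bcMatZ_pow (m N : ℕ) [NeZero N] (hm : m ∣ N) (x : BCidx m N hm → ℝ) (n : ℕ) :
    ∀ i j : ZMod N, ((bcMatZ m N hm x) ^ n) i j =
      ∑ d : Fin n → ZMod N, (if i + ∑ t, d t = j then 1 else 0) *
        ∏ t, x (bcWord m N hm n i d t) := by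
  induction n with
  | zero => intro i j; simp [Matrix.one_apply]
  | succ n ih =>
    intro i j
    rw [pow_succ', Matrix.mul_apply, ← (Fin.consEquiv (fun _ => ZMod N)).sum_comp,
      Fintype.sum_prod_type, ← Equiv.sum_comp (Equiv.addLeft i)]
    refine Finset.sum_congr rfl fun y _ => ?_
    rw [ih, Finset.mul_sum]
    refine Finset.sum_congr rfl fun d _ => ?_
    simp [Fin.consEquiv, Fin.sum_univ_succ, Fin.prod_univ_succ, bcWord_cons_zero, bcWord_cons_succ, bcMatZ, add_assoc]

lemma bc_trace (m N : ℕ) [NeZero N] (hm : m ∣ N) (x : BCidx m N hm → ℝ) (n : ℕ) :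
    Matrix.trace ((BCmat m N hm x) ^ n) = ∑ i : ZMod N,
      ∑ d : Fin n → ZMod N, (if i + ∑ t, d t = i then (1:ℝ) else 0) *
        ∏ t, x (bcWord m N hm n i d t) := by
  have hb : Function.Bijective (fun i : Fin N => ((i : ℕ) : ZMod N)) := by
    rw [Fintype.bijective_iff_injective_and_card]
    refine ⟨fun a b h => ?_, by simp [ZMod.card]⟩
    have := (ZMod.natCast_eq_natCast_iff' _ _ _).1 h
    rw [Nat.mod_eq_of_lt a.2, Nat.mod_eq_of_lt b.2] at this
    exact Fin.ext this
  let e : Fin N ≃ ZMod N := Equiv.ofBijective _ hb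
  have h1 : BCmat m N hm x = (bcMatZ m N hm x).submatrix e e := rfl
  have h2 : ∀ n, (BCmat m N hm x) ^ n = ((bcMatZ m N hm x) ^ n).submatrix e e := by
    intro n
    induction n with
    | zero => simp
    | succ n ih => rw [pow_succ, pow_succ, ih, h1, Matrix.submatrix_mul_equiv]
  rw [h2, Matrix.trace, ← e.sum_comp]
  refine Finset.sum_congr rfl fun i _ => ?_
  rw [Matrix.diag_apply, Matrix.submatrix_apply, bcMatZ_pow]

lemma prod_word {S : Type*} [Fintype S] [DecidableEq S] {n : ℕ} (w : Fin n → S) (x : S → ℝ) :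
    ∏ t, x (w t) = ∏ s, x s ^ (Finset.univ.filter (fun t => w t = s)).card := by
  rw [← Finset.prod_fiberwise Finset.univ w]
  refine Finset.prod_congr rfl fun s _ => ?_
  rw [Finset.prod_congr rfl (g := fun _ => x s), Finset.prod_const]
  intro t ht
  rw [(Finset.mem_filter.1 ht).2]

lemma word_integrable {S : Type*} [Fintype S] (μ : Measure ℝ) [IsProbabilityMeasure μ]
    (hmom : ∀ n : ℕ, Integrable (fun x : ℝ => x ^ n) μ) {n : ℕ} (w : Fin n → S) :
    Integrable (fun x : S → ℝ => ∏ t, x (w t)) (Measure.pi fun _ => μ) := by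
  classical
  simp only [prod_word]
  exact Integrable.fintype_prod (f := fun s y => y ^ (Finset.univ.filter (fun t => w t = s)).card)
    (fun s => hmom _)

lemma word_integral {S : Type*} [Fintype S] [DecidableEq S] (μ : Measure ℝ) [IsProbabilityMeasure μ]
    {n : ℕ} (w : Fin n → S) :
    ∫ x : S → ℝ, ∏ t, x (w t) ∂(Measure.pi fun _ => μ) =
      ∏ s, ∫ y, y ^ (Finset.univ.filter (fun t => w t = s)).card ∂μ := by
  simp only [prod_word]
  exact integral_fintype_prod_eq_prod (μ := fun _ => μ) (𝕜 := ℝ)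
    (f := fun s y => y ^ (Finset.univ.filter (fun t => w t = s)).card)

/-- A bound for the absolute moments up to order `n`. -/
noncomputable def momB (μ : Measure ℝ) (n : ℕ) : ℝ :=
  1 + ∑ c ∈ Finset.range (n + 1), |∫ y, y ^ c ∂μ|

lemma one_le_momB (μ : Measure ℝ) (n : ℕ) : 1 ≤ momB μ n := by
  have : 0 ≤ ∑ c ∈ Finset.range (n + 1), |∫ y, y ^ c ∂μ| :=
    Finset.sum_nonneg fun _ _ => abs_nonneg _
  unfold momB; linarith

lemma word_bound {S : Type*} [Fintype S] (μ : Measure ℝ) [IsProbabilityMeasure μ]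
    {n : ℕ} (w : Fin n → S) :
    |∫ x : S → ℝ, ∏ t, x (w t) ∂(Measure.pi fun _ => μ)| ≤ momB μ n ^ n := by
  classical
  rw [word_integral, Finset.abs_prod]
  have hsum : ∑ s, (Finset.univ.filter (fun t => w t = s)).card = n := by
    have := Finset.card_eq_sum_card_fiberwise (f := w) (s := Finset.univ) (t := Finset.univ)
      (by intro x _; simp)
    simpa using this.symm
  rw [show momB μ n ^ n = momB μ n ^ (∑ s, (Finset.univ.filter (fun t => w t = s)).card) by rw [hsum]]
  rw [← Finset.prod_pow_eq_pow_sum]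
  refine Finset.prod_le_prod (fun _ _ => abs_nonneg _) fun s _ => ?_
  set c := (Finset.univ.filter (fun t => w t = s)).card with hc
  have hcn : c ≤ n := by
    calc c ≤ (Finset.univ : Finset (Fin n)).card := Finset.card_filter_le _ _
      _ = n := by simp
  rcases Nat.eq_zero_or_pos c with h0 | h0
  · simp [h0]
  · calc |∫ y, y ^ c ∂μ| ≤ ∑ c ∈ Finset.range (n + 1), |∫ y, y ^ c ∂μ| :=
          Finset.single_le_sum (f := fun c => |∫ y, y ^ c ∂μ|) (fun _ _ => abs_nonneg _)
            (by simp; omega)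
      _ ≤ momB μ n := by unfold momB; linarith
      _ ≤ momB μ n ^ c := le_self_pow₀ (one_le_momB μ n) (by omega)

lemma word_card {S : Type*} [Fintype S] [DecidableEq S] (μ : Measure ℝ) [IsProbabilityMeasure μ]
    (hmean : ∫ x : ℝ, x ∂μ = 0) {k : ℕ} (w : Fin (2 * k + 1) → S)
    (h : ∫ x : S → ℝ, ∏ t, x (w t) ∂(Measure.pi fun _ => μ) ≠ 0) :
    (Finset.univ.image w).card ≤ k := by
  rw [word_integral, Finset.prod_ne_zero_iff] at h
  have h2 : ∀ s ∈ Finset.univ.image w, 2 ≤ (Finset.univ.filter (fun t => w t = s)).card := by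
    intro s hs
    have h1 : (Finset.univ.filter (fun t => w t = s)).card ≠ 1 := by
      intro h1
      have := h s (Finset.mem_univ _)
      rw [h1] at this
      simp [hmean] at this
    have h0 : 0 < (Finset.univ.filter (fun t => w t = s)).card := by
      obtain ⟨t, _, ht⟩ := Finset.mem_image.1 hs
      exact Finset.card_pos.2 ⟨t, by simp [ht]⟩
    omega
  have h3 := Finset.card_eq_sum_card_image w (Finset.univ)
  have h4 := Finset.card_nsmul_le_sum _ _ _ h2
  rw [← h3] at h4
  simp at h4
  omega

/-- Reconstruction of increments from the data (matching, signs, values). -/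
def decode (N k n : ℕ) (p : (Fin n → Fin k) × (Fin n → Bool) × (Fin k → ZMod N)) :
    Fin n → ZMod N :=
  fun t => if p.2.1 t then p.2.2 (p.1 t) else -p.2.2 (p.1 t)

lemma exists_decode (m N : ℕ) (hm : m ∣ N) [DecidableEq (BCidx m N hm)] (n k : ℕ) (i : ZMod N)
    (d : Fin n → ZMod N)
    (h : (Finset.univ.image (bcWord m N hm n i d)).card ≤ k) :
    ∃ p, decode N k n p = d := by
  set w := bcWord m N hm n i d with hw
  set T := Finset.univ.image w with hT
  obtain ⟨e⟩ : Nonempty (T ↪ Fin k) := by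
    apply Function.Embedding.nonempty_of_card_le
    simpa using h
  let f : Fin n → T := fun t => ⟨w t, Finset.mem_image_of_mem _ (Finset.mem_univ _)⟩
  let g : Fin k → ZMod N := Function.extend e (fun s => (Quot.out s.1).1) 0
  have hg : ∀ t, d t = g (e (f t)) ∨ d t = - g (e (f t)) := by
    intro t
    have h1 : g (e (f t)) = (Quot.out (w t)).1 := e.injective.extend_apply _ _ _
    rw [h1]
    obtain ⟨r, hr⟩ := bcWord_fst m N hm n i d t
    exact bc_quot m N hm (d t, r) (Quot.out (w t)) (hr.symm.trans (Quot.out_eq (w t)).symm)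
  classical
  refine ⟨(fun t => e (f t), fun t => decide (d t = g (e (f t))), g), ?_⟩
  funext t
  by_cases hh : d t = g (e (f t))
  · simp [decode, ← hh]
  · have := (hg t).resolve_left hh
    simp only [decode, hh]
    simp [this]

lemma expTrace_bound (μ : Measure ℝ) [IsProbabilityMeasure μ]
    (hmean : ∫ x : ℝ, x ∂μ = 0)
    (hmom : ∀ n : ℕ, Integrable (fun x : ℝ => x ^ n) μ)
    (m k N : ℕ) (hm : m ∣ N) (hN : N ≠ 0) :
    |expTrace μ m N (2 * k + 1) hm hN| ≤
      ((k : ℝ) ^ (2 * k + 1) * 2 ^ (2 * k + 1) * momB μ (2 * k + 1) ^ (2 * k + 1)) *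
        (N : ℝ) ^ (k + 1) := by
  classical
  unfold expTrace
  haveI : NeZero N := ⟨hN⟩
  haveI : NeZero m := ⟨by rintro rfl; exact hN (zero_dvd_iff.mp hm)⟩
  haveI : Finite (BCidx m N hm) := Finite.of_surjective _ (fun q => Quot.exists_rep q)
  letI : Fintype (BCidx m N hm) := Fintype.ofFinite _
  change |∫ x : BCidx m N hm → ℝ, Matrix.trace ((BCmat m N hm x) ^ (2 * k + 1))
    ∂(Measure.pi fun _ => μ)| ≤ _
  simp only [bc_trace]
  set n := 2 * k + 1 with hn
  set B := momB μ n ^ n with hB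
  have hB0 : 0 ≤ B := pow_nonneg (zero_le_one.trans (one_le_momB μ n)) _
  have hint : ∀ (i : ZMod N) (d : Fin n → ZMod N), Integrable (fun x : BCidx m N hm → ℝ =>
      (if i + ∑ t, d t = i then (1:ℝ) else 0) * ∏ t, x (bcWord m N hm n i d t))
      (Measure.pi fun _ => μ) := fun i d => (word_integrable μ hmom _).const_mul _
  rw [integral_finsetSum _ (fun i _ => integrable_finsetSum _ (fun d _ => hint i d))]
  set D : Finset (Fin n → ZMod N) := Finset.univ.image (decode N k n) with hD
  have hDc : (D.card : ℝ) ≤ (k : ℝ) ^ n * 2 ^ n * (N : ℝ) ^ k := by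
    have : D.card ≤ k ^ n * (2 ^ n * N ^ k) := by
      refine Finset.card_image_le.trans (le_of_eq ?_)
      simp [Fintype.card_prod, ZMod.card]
    rw [mul_assoc]
    exact_mod_cast this
  have key : ∀ i : ZMod N, |∫ x : BCidx m N hm → ℝ, ∑ d : Fin n → ZMod N,
      (if i + ∑ t, d t = i then (1:ℝ) else 0) * ∏ t, x (bcWord m N hm n i d t)
      ∂(Measure.pi fun _ => μ)| ≤ D.card * B := by
    intro i
    rw [integral_finsetSum _ (fun d _ => hint i d)]
    refine (Finset.abs_sum_le_sum_abs _ _).trans ?_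
    rw [← nsmul_eq_mul, ← Finset.sum_const, ← Finset.sum_subset (Finset.subset_univ D)]
    · refine Finset.sum_le_sum fun d _ => ?_
      rw [integral_const_mul, abs_mul]
      refine (mul_le_of_le_one_left (abs_nonneg _) ?_).trans (word_bound μ _)
      split_ifs <;> simp
    · intro d _ hd
      rw [integral_const_mul, abs_eq_zero]
      refine mul_eq_zero_of_right _ ?_
      by_contra hne
      obtain ⟨p, hp⟩ := exists_decode m N hm n k i d (word_card μ hmean _ hne)
      exact hd (Finset.mem_image.2 ⟨p, Finset.mem_univ _, hp⟩)
  refine (Finset.abs_sum_le_sum_abs _ _).trans ?_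
  refine (Finset.sum_le_sum fun i _ => key i).trans ?_
  rw [Finset.sum_const, nsmul_eq_mul, Finset.card_univ, ZMod.card]
  have hN0 : (0:ℝ) ≤ N := Nat.cast_nonneg _
  calc (N:ℝ) * (D.card * B) ≤ N * (((k : ℝ) ^ n * 2 ^ n * (N : ℝ) ^ k) * B) := by gcongr
    _ = _ := by ring

end helpers

/-- the expected odd trace moments are `O(N^{k+1})`, so the normalized odd
moments `N^{-(k+3/2)} E[Tr(A^{2k+1})]` are `O(N^{-1/2})` and tend to `0` as `N → ∞`
over positive multiples of `m`. -/
theorem odd_moments_vanish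
    (μ : Measure ℝ) [IsProbabilityMeasure μ]
    (hmean : ∫ x : ℝ, x ∂μ = 0) (hvar : ∫ x : ℝ, x ^ 2 ∂μ = 1)
    (hmom : ∀ n : ℕ, Integrable (fun x : ℝ => x ^ n) μ)
    (m k : ℕ) (hm : 1 ≤ m) :
    ∃ C : ℝ, (∀ (N : ℕ) (hdvd : m ∣ N) (hN : N ≠ 0),
        |expTrace μ m N (2 * k + 1) hdvd hN| ≤ C * (N : ℝ) ^ (k + 1)) ∧
      Tendsto
        (fun j : ℕ =>
          (Real.sqrt ((m * (j + 1) : ℕ)) * ((m * (j + 1) : ℕ) : ℝ) ^ (k + 1))⁻¹ *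
            expTrace μ m (m * (j + 1)) (2 * k + 1) (dvd_mul_right m (j + 1))
              (Nat.mul_ne_zero (by omega) (by omega)))
        atTop (nhds 0) := by
  refine ⟨(k : ℝ) ^ (2 * k + 1) * 2 ^ (2 * k + 1) * momB μ (2 * k + 1) ^ (2 * k + 1),
    fun N hdvd hN => expTrace_bound μ hmean hmom m k N hdvd hN, ?_⟩
  set C := (k : ℝ) ^ (2 * k + 1) * 2 ^ (2 * k + 1) * momB μ (2 * k + 1) ^ (2 * k + 1) with hC
  have hlim : Tendsto (fun j : ℕ => C * (Real.sqrt ((m * (j + 1) : ℕ)))⁻¹) atTop (nhds 0) := by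
    rw [← mul_zero C]
    refine Tendsto.const_mul C (tendsto_inv_atTop_zero.comp ?_)
    refine Real.tendsto_sqrt_atTop.comp (tendsto_natCast_atTop_atTop.comp ?_)
    exact tendsto_atTop_mono (fun j => by show j ≤ m * (j + 1); nlinarith) tendsto_id
  refine squeeze_zero_norm (fun j => ?_) hlim
  have hb := expTrace_bound μ hmean hmom m k (m * (j + 1)) (dvd_mul_right m (j + 1))
    (Nat.mul_ne_zero (by omega) (by omega))
  rw [← hC] at hb
  have hpos : (0:ℝ) < ((m * (j + 1) : ℕ) : ℝ) := by
    have : 0 < m * (j + 1) := Nat.mul_pos (by omega) (by omega)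
    exact_mod_cast this
  have hs := Real.sqrt_pos.2 hpos
  rw [norm_mul, norm_inv, Real.norm_of_nonneg (by positivity), Real.norm_eq_abs]
  refine (mul_le_mul_of_nonneg_left hb (by positivity)).trans (le_of_eq ?_)
  field_simp
end

section
/- For every integer m ≥ 1, every integer k ≥ 1 and every ε > 0, the probability ℙ(m,N)( { x : |N^{−(k+1)} · Tr(A(x)^{2k}) − Σ_{σ ∈ P(2k)} m^{−(k+1−v(σ))}| > ε } ) tends to 0 as N → ∞ over positive multiples of m; likewise ℙ(m,N)( { x : N^{−(k+3/2)} · |Tr(A(x)^{2k+1})| > ε } ) tends to 0. That is, the moments of the empirical spectral measures converge in probability to the limiting moments. -/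
open MeasureTheory Filter

/-- A pairing: a fixed-point-free involution of `ZMod n`. -/
abbrev Pairing (n : ℕ) : Type :=
  {σ : Equiv.Perm (ZMod n) // (∀ j, σ (σ j) = j) ∧ ∀ j, σ j ≠ j}

noncomputable instance (n : ℕ) [NeZero n] : Fintype (Pairing n) :=
  Fintype.ofFinite _

/-- `v(σ)`: the number of equivalence classes of `ZMod n` under the smallest equivalence
relation relating `j` and `σ j + 1`. -/
noncomputable def vfun (n : ℕ) (σ : Equiv.Perm (ZMod n)) : ℕ :=
  Nat.card (Quot (fun a b : ZMod n => b = σ a + 1))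

/-- The probability (under the i.i.d. product measure) that the block circulant matrix `A(x)`
satisfies a predicate `P`. -/
noncomputable def probMat (μ : Measure ℝ) (m N : ℕ) (hm : m ∣ N) (hN : N ≠ 0)
    (P : Matrix (Fin N) (Fin N) ℝ → Prop) : ENNReal :=
  haveI : NeZero N := ⟨hN⟩
  haveI : NeZero m := ⟨by rintro rfl; exact hN (zero_dvd_iff.mp hm)⟩
  haveI : Finite (BCidx m N hm) := Finite.of_surjective _ (fun q => Quot.exists_rep q)
  haveI : Fintype (BCidx m N hm) := Fintype.ofFinite _
  Measure.pi (fun _ : BCidx m N hm => μ) {x | P (BCmat m N hm x)}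


namespace BC
open Finset

section Prob

open Classical in
/-- multiplicity of the value `q` in the word `c` -/
noncomputable def mlt {J Q : Type*} [Fintype J] (c : J → Q) (q : Q) : ℕ :=
  (univ.filter (fun s => c s = q)).card

/-- expectation of the monomial attached to the word `c` -/
noncomputable def Fm (μ : Measure ℝ) {J Q : Type*} [Fintype J] [Fintype Q] (c : J → Q) : ℝ :=
  ∏ q, ∫ x : ℝ, x ^ (mlt c q) ∂μ

lemma prod_word {J Q : Type*} [Fintype J] [Fintype Q] (c : J → Q) (x : Q → ℝ) :
    ∏ s, x (c s) = ∏ q, (x q) ^ (mlt c q) := by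
  classical
  rw [← Finset.prod_fiberwise' univ c x]
  refine Finset.prod_congr rfl fun q _ => ?_
  rw [Finset.prod_const, mlt]

lemma integrable_word (μ : Measure ℝ) [IsProbabilityMeasure μ]
    (hmom : ∀ n : ℕ, Integrable (fun x : ℝ => x ^ n) μ)
    {J Q : Type*} [Fintype J] [Fintype Q] (c : J → Q) :
    Integrable (fun x : Q → ℝ => ∏ s, x (c s)) (Measure.pi fun _ => μ) := by
  simp_rw [prod_word]
  exact Integrable.fintype_prod (f := fun q (y : ℝ) => y ^ (mlt c q)) (fun q => hmom _)

lemma integral_word (μ : Measure ℝ) [IsProbabilityMeasure μ]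
    {J Q : Type*} [Fintype J] [Fintype Q] (c : J → Q) :
    ∫ x : Q → ℝ, ∏ s, x (c s) ∂(Measure.pi fun _ => μ) = Fm μ c := by
  simp_rw [prod_word]
  exact integral_fintype_prod_eq_prod (f := fun q (y : ℝ) => y ^ (mlt c q))

lemma sum_mlt {J Q : Type*} [Fintype J] [Fintype Q] (c : J → Q) :
    ∑ q, mlt c q = Fintype.card J := by
  classical
  rw [← Finset.card_univ, Finset.card_eq_sum_card_fiberwise (f := c) (t := univ) (by simp)]
  refine Finset.sum_congr rfl fun q _ => ?_
  rw [mlt]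

lemma mlt_le {J Q : Type*} [Fintype J] (c : J → Q) (q : Q) : mlt c q ≤ Fintype.card J := by
  classical
  exact Finset.card_le_univ _

/-- uniform moment bound -/
lemma exists_bound (μ : Measure ℝ) [IsProbabilityMeasure μ] (L : ℕ) :
    ∃ K : ℝ, 1 ≤ K ∧ ∀ a ≤ L, |∫ x : ℝ, x ^ a ∂μ| ≤ K ^ a := by
  refine ⟨1 + ∑ a ∈ range (L+1), |∫ x : ℝ, x ^ a ∂μ|, ?_, ?_⟩
  · have : 0 ≤ ∑ a ∈ range (L+1), |∫ x : ℝ, x ^ a ∂μ| := Finset.sum_nonneg fun _ _ => abs_nonneg _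
    linarith
  · intro a ha
    rcases Nat.eq_zero_or_pos a with rfl | h
    · simp
    have h1 : |∫ x : ℝ, x ^ a ∂μ| ≤ ∑ a ∈ range (L+1), |∫ x : ℝ, x ^ a ∂μ| :=
      Finset.single_le_sum (f := fun a : ℕ => |∫ x : ℝ, x ^ a ∂μ|) (fun _ _ => abs_nonneg _)
        (by simp; omega)
    have h0 : 0 ≤ ∑ a ∈ range (L+1), |∫ x : ℝ, x ^ a ∂μ| := Finset.sum_nonneg fun _ _ => abs_nonneg _
    calc |∫ x : ℝ, x ^ a ∂μ| ≤ 1 + ∑ a ∈ range (L+1), |∫ x : ℝ, x ^ a ∂μ| := by linarith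
      _ ≤ _ := le_self_pow₀ (by linarith) (by omega)

lemma Fm_bound (μ : Measure ℝ) {J Q : Type*} [Fintype J] [Fintype Q] (c : J → Q)
    (K : ℝ) (hK : ∀ a ≤ Fintype.card J, |∫ x : ℝ, x ^ a ∂μ| ≤ K ^ a) :
    |Fm μ c| ≤ K ^ (Fintype.card J) := by
  rw [Fm, Finset.abs_prod, ← sum_mlt c, ← Finset.prod_pow_eq_pow_sum]
  exact Finset.prod_le_prod (fun _ _ => abs_nonneg _) fun q _ => hK _ (mlt_le c q)

lemma Fm_zero (μ : Measure ℝ) (hmean : ∫ x : ℝ, x ∂μ = 0)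
    {J Q : Type*} [Fintype J] [Fintype Q] (c : J → Q) (s : J)
    (h : ∀ t, c t = c s → t = s) : Fm μ c = 0 := by
  classical
  refine Finset.prod_eq_zero (mem_univ (c s)) ?_
  have : mlt c (c s) = 1 := by
    rw [mlt, Finset.card_eq_one]
    refine ⟨s, ?_⟩
    ext t; simp only [mem_filter, mem_univ, true_and, mem_singleton]
    exact ⟨h t, fun h => h ▸ rfl⟩
  simp [this, hmean]

lemma Fm_one (μ : Measure ℝ) [IsProbabilityMeasure μ] (hvar : ∫ x : ℝ, x ^ 2 ∂μ = 1)
    {J Q : Type*} [Fintype J] [Fintype Q] (c : J → Q)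
    (h : ∀ s, ∃ t, t ≠ s ∧ ∀ u, c u = c s ↔ u = s ∨ u = t) : Fm μ c = 1 := by
  classical
  refine Finset.prod_eq_one fun q _ => ?_
  by_cases hq : ∃ s, c s = q
  · obtain ⟨s, rfl⟩ := hq
    obtain ⟨t, hts, hu⟩ := h s
    have : mlt c (c s) = 2 := by
      rw [mlt, Finset.card_eq_two]
      refine ⟨s, t, hts.symm, ?_⟩
      ext u; simp [hu]
    simp [this, hvar]
  · have : mlt c q = 0 := by
      rw [mlt, Finset.card_eq_zero]
      ext u; simp; exact fun h => hq ⟨u, h⟩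
    simp [this]

lemma mlt_sum {J J' Q : Type*} [Fintype J] [Fintype J'] (c : J → Q) (c' : J' → Q) (q : Q) :
    mlt (Sum.elim c c') q = mlt c q + mlt c' q := by
  classical
  simp only [mlt]
  rw [← Fintype.card_subtype, ← Fintype.card_subtype, ← Fintype.card_subtype, ← Fintype.card_sum]
  refine Fintype.card_congr ?_
  refine (Equiv.subtypeSum).trans ?_
  exact Equiv.sumCongr (Equiv.refl _) (Equiv.refl _)

lemma Fm_mul (μ : Measure ℝ) [IsProbabilityMeasure μ]
    {J J' Q : Type*} [Fintype J] [Fintype J'] [Fintype Q] (c : J → Q) (c' : J' → Q)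
    (h : ∀ s t, c s ≠ c' t) : Fm μ (Sum.elim c c') = Fm μ c * Fm μ c' := by
  classical
  rw [Fm, Fm, Fm, ← Finset.prod_mul_distrib]
  refine Finset.prod_congr rfl fun q _ => ?_
  rw [mlt_sum]
  by_cases hq : ∃ s, c s = q
  · obtain ⟨s, rfl⟩ := hq
    have : mlt c' (c s) = 0 := by
      rw [mlt, Finset.card_eq_zero]
      ext u; simp; exact fun h' => h s u h'.symm
    simp [this]
  · have : mlt c q = 0 := by
      rw [mlt, Finset.card_eq_zero]
      ext u; simp; exact fun h => hq ⟨u, h⟩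
    simp [this]

lemma prob_bound (μ : Measure ℝ) [IsProbabilityMeasure μ]
    (hmom : ∀ n : ℕ, Integrable (fun x : ℝ => x ^ n) μ)
    {I J Q : Type*} [Fintype I] [Fintype J] [Fintype Q] (c : I → J → Q) (w L ε : ℝ) (hε : 0 < ε) :
    Measure.pi (fun _ : Q => μ) {x | ε < |w * (∑ i, ∏ s, x (c i s)) - L|} ≤
      ENNReal.ofReal ((w ^ 2 * (∑ i, ∑ i', (Fm μ (Sum.elim (c i) (c i')) - Fm μ (c i) * Fm μ (c i')))
        + (w * (∑ i, Fm μ (c i)) - L) ^ 2) / ε ^ 2) := by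
  set P := Measure.pi (fun _ : Q => μ) with hP
  set T : (Q → ℝ) → ℝ := fun x => ∑ i, ∏ s, x (c i s) with hT
  have hTi : Integrable T P := integrable_finsetSum _ fun i _ => integrable_word μ hmom (c i)
  have hTI : ∫ x, T x ∂P = ∑ i, Fm μ (c i) := by
    rw [hT, integral_finsetSum _ fun i _ => integrable_word μ hmom (c i)]
    exact Finset.sum_congr rfl fun i _ => integral_word μ (c i)
  have hT2 : ∀ x, T x ^ 2 = ∑ i, ∑ i', ∏ s, x (Sum.elim (c i) (c i') s) := by
    intro x
    rw [hT, sq, Finset.sum_mul_sum]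
    refine Finset.sum_congr rfl fun i _ => Finset.sum_congr rfl fun i' _ => ?_
    simp [Fintype.prod_sum_type]
  have hT2i : Integrable (fun x => T x ^ 2) P := by
    simp_rw [hT2]
    exact integrable_finsetSum _ fun i _ => integrable_finsetSum _ fun i' _ =>
      integrable_word μ hmom _
  have hT2I : ∫ x, T x ^ 2 ∂P = ∑ i, ∑ i', Fm μ (Sum.elim (c i) (c i')) := by
    simp_rw [hT2]
    rw [integral_finsetSum _ fun i _ => integrable_finsetSum _ fun i' _ =>
      integrable_word μ hmom _]
    refine Finset.sum_congr rfl fun i _ => ?_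
    rw [integral_finsetSum _ fun i' _ => integrable_word μ hmom _]
    exact Finset.sum_congr rfl fun i' _ => integral_word μ _
  have hexp : ∀ x, (w * T x - L) ^ 2 = w ^ 2 * T x ^ 2 - 2 * w * L * T x + L ^ 2 := by
    intro x; ring
  have hi : Integrable (fun x => (w * T x - L) ^ 2) P := by
    simp_rw [hexp]
    exact ((hT2i.const_mul _).sub (hTi.const_mul _)).add (integrable_const _)
  have hI : ∫ x, (w * T x - L) ^ 2 ∂P = w ^ 2 * (∑ i, ∑ i', (Fm μ (Sum.elim (c i) (c i')) - Fm μ (c i) * Fm μ (c i')))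
        + (w * (∑ i, Fm μ (c i)) - L) ^ 2 := by
    simp_rw [hexp]
    have hsub : Integrable (fun x => w ^ 2 * T x ^ 2 - 2 * w * L * T x) P :=
      (hT2i.const_mul _).sub (hTi.const_mul _)
    rw [integral_add hsub (integrable_const _),
      integral_sub (hT2i.const_mul _) (hTi.const_mul _), integral_const_mul, integral_const_mul,
      hTI, hT2I]
    simp only [Finset.sum_sub_distrib, ← Finset.sum_mul_sum]
    simp
    ring
  have hm := mul_meas_ge_le_integral_of_nonneg (μ := P)
    (Filter.Eventually.of_forall fun x => sq_nonneg (w * T x - L)) hi (ε ^ 2)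
  rw [hI] at hm
  rw [← ENNReal.ofReal_toReal (measure_ne_top P {x | ε < |w * T x - L|})]
  apply ENNReal.ofReal_le_ofReal
  rw [le_div_iff₀ (by positivity), mul_comm]
  refine le_trans ?_ hm
  refine mul_le_mul_of_nonneg_left ?_ (by positivity)
  refine measureReal_mono ?_
  intro x hx
  simp only [Set.mem_ofPred_eq] at hx ⊢
  rw [← sq_abs (w * T x - L)]
  exact pow_le_pow_left₀ hε.le hx.le 2

end Prob
end BC

namespace BC
open Finset

section Trace

variable {V : Type*}

/-- weight of an open path -/
def Wt (A : Matrix V V ℝ) (n : ℕ) (p : Fin (n+1) → V) (b : V) : ℝ :=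
  (∏ s : Fin n, A (p s.castSucc) (p s.succ)) * A (p (Fin.last n)) b

lemma Wt_cons (A : Matrix V V ℝ) (n : ℕ) (a : V) (p : Fin (n+1) → V) (b : V) :
    Wt A (n+1) (Fin.cons a p) b = A a (p 0) * Wt A n p b := by
  unfold Wt
  rw [Fin.prod_univ_succ]
  have : (Fin.last (n+1)) = (Fin.last n).succ := rfl
  simp only [this, Fin.cons_succ, Fin.castSucc_zero, Fin.cons_zero, ← Fin.succ_castSucc, mul_assoc]

lemma sum_cons [Fintype V] {β : Type*} [AddCommMonoid β] (n : ℕ) (f : (Fin (n+1) → V) → β) :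
    ∑ p, f p = ∑ a, ∑ p : Fin n → V, f (Fin.cons a p) := by
  rw [← (Fin.consEquiv (fun _ : Fin (n+1) => V)).sum_comp, Fintype.sum_prod_type]
  rfl

lemma pow_paths [Fintype V] [DecidableEq V] (A : Matrix V V ℝ) (n : ℕ) (a b : V) :
    (A ^ (n+1)) a b = ∑ p : Fin n → V, Wt A n (Fin.cons a p) b := by
  induction n generalizing a with
  | zero => simp [Wt]
  | succ n ih =>
    rw [pow_succ', Matrix.mul_apply, sum_cons]
    refine Finset.sum_congr rfl fun c _ => ?_
    rw [ih, Finset.mul_sum]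
    refine Finset.sum_congr rfl fun p _ => ?_
    rw [Wt_cons]; rfl

lemma trace_pow_fin [Fintype V] [DecidableEq V] (A : Matrix V V ℝ) (n : ℕ) :
    Matrix.trace (A ^ (n+1)) = ∑ p : Fin (n+1) → V, ∏ s, A (p s) (p (s+1)) := by
  rw [sum_cons, Matrix.trace]
  refine Finset.sum_congr rfl fun a _ => ?_
  rw [Matrix.diag_apply, pow_paths]
  refine Finset.sum_congr rfl fun p _ => ?_
  rw [Fin.prod_univ_castSucc, Wt]
  simp [Fin.coeSucc_eq_succ]

lemma trace_pow_zmod [Fintype V] [DecidableEq V] (A : Matrix V V ℝ) (n : ℕ) [NeZero n] :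
    Matrix.trace (A ^ n) = ∑ p : ZMod n → V, ∏ s, A (p s) (p (s+1)) := by
  obtain ⟨n, rfl⟩ := Nat.exists_eq_succ_of_ne_zero (NeZero.ne n)
  exact trace_pow_fin A n

end Trace

/-- word of a circuit -/
def cw {m N : ℕ} (hm : m ∣ N) {n : ℕ} (i : ZMod n → ZMod N) (s : ZMod n) : BCidx m N hm :=
  Quot.mk _ (i (s+1) - i s, ZMod.castHom hm (ZMod m) (i s))

lemma trace_BC {m N : ℕ} [NeZero N] (hm : m ∣ N) (n : ℕ) [NeZero n] (x : BCidx m N hm → ℝ) :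
    Matrix.trace (BCmat m N hm x ^ n) = ∑ i : ZMod n → ZMod N, ∏ s, x (cw hm i s) := by
  rw [trace_pow_zmod]
  have hb : Function.Bijective (fun i : Fin N => ((i : ℕ) : ZMod N)) := by
    rw [Fintype.bijective_iff_injective_and_card]
    refine ⟨fun a b h => ?_, by simp [ZMod.card]⟩
    have h' := congrArg ZMod.val h
    simp only [ZMod.val_natCast] at h'
    rw [Nat.mod_eq_of_lt a.2, Nat.mod_eq_of_lt b.2] at h'
    exact Fin.ext h'
  let e := Equiv.ofBijective _ hb
  rw [← ((Equiv.refl (ZMod n)).arrowCongr e).sum_comp]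
  rfl

/-- the involution -/
def tau {m N : ℕ} (hm : m ∣ N) (a : ZMod N × ZMod m) : ZMod N × ZMod m :=
  (-a.1, a.2 + ZMod.castHom hm (ZMod m) a.1)

lemma tau_tau {m N : ℕ} (hm : m ∣ N) (a : ZMod N × ZMod m) : tau hm (tau hm a) = a := by
  apply Prod.ext
  · simp [tau]
  · simp only [tau, map_neg]; ring

lemma quot_eq {m N : ℕ} (hm : m ∣ N) (a b : ZMod N × ZMod m) :
    (Quot.mk _ a : BCidx m N hm) = Quot.mk _ b ↔ b = a ∨ b = tau hm a := by
  constructor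
  · intro h
    have h' := Quot.eqvGen_exact h
    clear h
    induction h' with
    | rel x y h => exact Or.inr h
    | refl x => exact Or.inl rfl
    | symm x y _ ih =>
      rcases ih with rfl | rfl
      · exact Or.inl rfl
      · right; rw [tau_tau]
    | trans x y z _ _ h1 h2 =>
      rcases h1 with rfl | rfl <;> rcases h2 with rfl | rfl
      · exact Or.inl rfl
      · exact Or.inr rfl
      · exact Or.inr rfl
      · left; rw [tau_tau]
  · rintro (rfl | rfl)
    · rfl
    · exact Quot.sound rfl

/-- differences -/
def df {N n : ℕ} (i : ZMod n → ZMod N) (s : ZMod n) : ZMod N := i (s+1) - i s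

lemma cw_eq {m N : ℕ} (hm : m ∣ N) {n n' : ℕ} (i : ZMod n → ZMod N) (i' : ZMod n' → ZMod N)
    (s : ZMod n) (t : ZMod n') :
    cw hm i s = cw hm i' t ↔
      (df i s = df i' t ∧ ZMod.castHom hm (ZMod m) (i s) = ZMod.castHom hm (ZMod m) (i' t)) ∨
      (df i s = - df i' t ∧
        ZMod.castHom hm (ZMod m) (i s) = ZMod.castHom hm (ZMod m) (i' (t+1))) := by
  rw [eq_comm]
  refine (quot_eq hm _ _).trans ?_
  simp only [tau, Prod.mk.injEq, df]
  refine or_congr Iff.rfl (and_congr Iff.rfl ?_)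
  rw [map_sub]; simp

lemma sum_df {N n : ℕ} [NeZero n] (i : ZMod n → ZMod N) : ∑ s, df i s = 0 := by
  simp only [df, Finset.sum_sub_distrib]
  rw [sub_eq_zero]
  exact Fintype.sum_equiv (Equiv.addRight (1 : ZMod n)) _ _ fun _ => rfl

lemma df_inj {A : Type*} [AddCommGroup A] {n : ℕ} [NeZero n] (i i' : ZMod n → A) (h0 : i 0 = i' 0)
    (h : ∀ s, i (s+1) - i s = i' (s+1) - i' s) : i = i' := by
  have key : ∀ r : ℕ, i (r : ZMod n) = i' (r : ZMod n) := by
    intro r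
    induction r with
    | zero => simpa using h0
    | succ r ih =>
      have := h (r : ZMod n)
      rw [ih] at this
      push_cast
      exact sub_left_injective this
  funext s
  have := key s.val
  simpa using this

end BC

namespace BC
open Finset

section Count

/-- equal up to sign -/
def RelD {J : Type*} {N : ℕ} (d : J → ZMod N) (s t : J) : Prop := d s = d t ∨ d s = - d t

lemma RelD.symm {J : Type*} {N : ℕ} {d : J → ZMod N} {s t : J} (h : RelD d s t) : RelD d t s := by
  rcases h with h | h
  · exact Or.inl h.symm
  · right; rw [h, neg_neg]

lemma RelD.trans {J : Type*} {N : ℕ} {d : J → ZMod N} {s t u : J} (h : RelD d s t)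
    (h' : RelD d t u) : RelD d s u := by
  unfold RelD at *
  rcases h with h | h <;> rcases h' with h' | h' <;> rw [h, h'] <;> simp

lemma exists_reps {J : Type*} {N : ℕ} (d : J → ZMod N) :
    ∃ f : J → J, (∀ s, RelD d s (f s)) ∧ (∀ s t, RelD d s t → f s = f t) := by
  let S : Setoid J := ⟨RelD d, fun _ => Or.inl rfl, fun h => h.symm, fun h h' => h.trans h'⟩
  refine ⟨fun s => (Quotient.mk S s).out, fun s => ?_, fun s t h => ?_⟩
  · exact RelD.symm (Quotient.mk_out (s := S) s)
  · have : Quotient.mk S s = Quotient.mk S t := Quotient.sound h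
    simp only [this]

lemma card_cover {X T : Type*} [Fintype T] (D : Finset X) (P : T → X → Prop) (B : ℕ)
    (h : ∀ x ∈ D, ∃ t, P t x) (hB : ∀ t, ∀ E : Finset X, E ⊆ D → (∀ x ∈ E, P t x) → E.card ≤ B) :
    D.card ≤ Fintype.card T * B := by
  classical
  have hsub : D ⊆ (univ : Finset T).biUnion (fun t => D.filter (P t)) := by
    intro x hx
    obtain ⟨t, ht⟩ := h x hx
    simp only [mem_biUnion, mem_univ, true_and, mem_filter]
    exact ⟨t, hx, ht⟩
  refine (card_le_card hsub).trans ?_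
  refine Finset.card_biUnion_le_card_mul _ _ _ fun t _ => ?_
  exact hB t _ (filter_subset _ _) (fun x hx => (mem_filter.mp hx).2)

lemma card_restr {J : Type*} {N : ℕ} [NeZero N] (E : Finset (J → ZMod N)) (R : Finset J) (b : ℕ)
    (hR : R.card ≤ b) (hinj : ∀ d ∈ E, ∀ d' ∈ E, (∀ r ∈ R, d r = d' r) → d = d') :
    E.card ≤ N ^ b := by
  classical
  have h1 : E.card ≤ (univ : Finset (R → ZMod N)).card := by
    refine Finset.card_le_card_of_injOn (fun d r => d r) (by simp) ?_
    intro d hd d' hd' h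
    refine hinj d hd d' hd' fun r hr => ?_
    exact congrFun h ⟨r, hr⟩
  refine h1.trans ?_
  rw [Finset.card_univ, Fintype.card_fun, ZMod.card, Fintype.card_coe]
  exact Nat.pow_le_pow_right (Nat.pos_of_ne_zero (NeZero.ne N)) hR

lemma RelD.sign {J : Type*} {N : ℕ} {d : J → ZMod N} {f : J → J} (h : ∀ s, RelD d s (f s))
    [∀ s, Decidable (d s = d (f s))] (s : J) :
    d s = if decide (d s = d (f s)) = true then d (f s) else - d (f s) := by
  by_cases hs : d s = d (f s)
  · rw [if_pos (by simpa using hs)]; exact hs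
  · simp only [hs, decide_false]
    rcases h s with h | h
    · exact absurd h hs
    · simpa using h

lemma count_A {J : Type*} [Fintype J] [DecidableEq J] {N : ℕ} [NeZero N] (b : ℕ)
    (D : Finset (J → ZMod N))
    (h : ∀ d ∈ D, ∃ f : J → J, (∀ s, RelD d s (f s)) ∧ (image f univ).card ≤ b) :
    D.card ≤ Fintype.card ((J → J) × (J → Bool)) * N ^ b := by
  classical
  refine card_cover D (fun (t : (J → J) × (J → Bool)) d =>
    (∀ s, d s = if t.2 s then d (t.1 s) else - d (t.1 s)) ∧ (image t.1 univ).card ≤ b) _ ?_ ?_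
  · intro d hd
    obtain ⟨f, hf, hb⟩ := h d hd
    exact ⟨(f, fun s => decide (d s = d (f s))), fun s => RelD.sign hf s, hb⟩
  · rintro ⟨f, ε⟩ E _ hE
    by_cases hb : (image f univ).card ≤ b
    · refine card_restr E (image f univ) b hb ?_
      intro d hd d' hd' hdd
      funext s
      rw [(hE d hd).1 s, (hE d' hd').1 s]
      simp only
      rw [hdd (f s) (mem_image_of_mem _ (mem_univ _))]
    · have : E = ∅ := by
        rw [Finset.eq_empty_iff_forall_notMem]
        intro d hd
        exact hb (hE d hd).2
      simp [this]

lemma two_mul_bit {N : ℕ} [NeZero N] (x y : ZMod N) (h : 2 * x = 2 * y)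
    (hb : decide (2 * x.val < N) = decide (2 * y.val < N)) : x = y := by
  apply ZMod.val_injective N
  have hx := ZMod.val_lt x
  have hy := ZMod.val_lt y
  have h1 : ((2 * x.val : ℕ) : ZMod N) = ((2 * y.val : ℕ) : ZMod N) := by
    push_cast; simpa using h
  rw [ZMod.natCast_eq_natCast_iff] at h1
  unfold Nat.ModEq at h1
  have hb' : (2 * x.val < N) ↔ (2 * y.val < N) := by simpa using hb
  by_cases hc : 2 * x.val < N
  · rw [Nat.mod_eq_of_lt hc, Nat.mod_eq_of_lt (hb'.1 hc)] at h1; omega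
  · have hc' : ¬ 2 * y.val < N := fun h => hc (hb'.2 h)
    rw [Nat.mod_eq_sub_mod (by omega), Nat.mod_eq_sub_mod (a := 2 * y.val) (by omega),
      Nat.mod_eq_of_lt (by omega), Nat.mod_eq_of_lt (by omega)] at h1
    omega

lemma count_B {J : Type*} [Fintype J] [DecidableEq J] {N : ℕ} [NeZero N] (b : ℕ) (S : Finset J)
    (D : Finset (J → ZMod N))
    (h : ∀ d ∈ D, ∑ s ∈ S, d s = 0 ∧ ∃ f : J → J, ∃ ε : J → Bool, ∃ r : J,
      (∀ s, d s = if ε s then d (f s) else - d (f s)) ∧ ((image f univ).erase r).card ≤ b ∧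
      (∑ s ∈ S.filter (fun s => f s = r), (if ε s then (1:ℤ) else -1)) ∣ 2) :
    D.card ≤ Fintype.card ((J → J) × (J → Bool) × J × Bool) * N ^ b := by
  classical
  refine card_cover D (fun (t : (J → J) × (J → Bool) × J × Bool) d =>
    (∀ s, d s = if t.2.1 s then d (t.1 s) else - d (t.1 s)) ∧
    ((image t.1 univ).erase t.2.2.1).card ≤ b ∧
    (∑ s ∈ S.filter (fun s => t.1 s = t.2.2.1), (if t.2.1 s then (1:ℤ) else -1)) ∣ 2 ∧
    t.2.2.2 = decide (2 * (d t.2.2.1).val < N)) _ ?_ ?_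
  · intro d hd
    obtain ⟨_, f, ε, r, h1, h2, h3⟩ := h d hd
    exact ⟨(f, ε, r, decide (2 * (d r).val < N)), h1, h2, h3, rfl⟩
  · rintro ⟨f, ε, r, bit⟩ E hED hE
    simp only at hE
    by_cases hemp : E = ∅
    · simp [hemp]
    obtain ⟨d0, hd0⟩ := Finset.nonempty_iff_ne_empty.mpr hemp
    obtain ⟨-, hcard, ⟨q, hq⟩, -⟩ := hE d0 hd0
    refine card_restr E ((image f univ).erase r) b hcard ?_
    intro d hd d' hd' hdd
    have hf : ∀ s, f s ≠ r → d s = d' s := by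
      intro s hs
      rw [(hE d hd).1 s, (hE d' hd').1 s,
        hdd (f s) (mem_erase.mpr ⟨hs, mem_image_of_mem _ (mem_univ _)⟩)]
    have hfr : ∀ s, f s = r → d s - d' s = ((if ε s then (1:ℤ) else -1 : ℤ) : ZMod N) * (d r - d' r) := by
      intro s hs
      rw [(hE d hd).1 s, (hE d' hd').1 s, hs]
      by_cases he : ε s <;> simp [he] ; ring
    have hsum : ∑ s ∈ S, (d s - d' s) = 0 := by
      rw [Finset.sum_sub_distrib, (h d (hED hd)).1, (h d' (hED hd')).1, sub_zero]
    rw [← Finset.sum_filter_add_sum_filter_not S (fun s => f s = r)] at hsum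
    rw [Finset.sum_eq_zero (s := S.filter (fun s => ¬ f s = r)) (fun s hs => by
      rw [hf s (mem_filter.mp hs).2, sub_self]), add_zero,
      Finset.sum_congr rfl (fun s hs => hfr s (mem_filter.mp hs).2), ← Finset.sum_mul,
      ← Int.cast_sum] at hsum
    have h2 : 2 * (d r - d' r) = 0 := by
      have : (2 : ZMod N) = ((2 : ℤ) : ZMod N) := by norm_num
      rw [this, hq, Int.cast_mul, mul_comm (Int.cast _) (Int.cast q), mul_assoc, hsum, mul_zero]
    have hr : d r = d' r := by
      apply two_mul_bit
      · rw [← sub_eq_zero, ← mul_sub, h2]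
      · rw [← (hE d hd).2.2.2, ← (hE d' hd').2.2.2]
    funext s
    rw [(hE d hd).1 s, (hE d' hd').1 s]
    by_cases hs : f s = r
    · rw [hs, hr]
    · rw [hdd (f s) (mem_erase.mpr ⟨hs, mem_image_of_mem _ (mem_univ _)⟩)]

/-- every block has at least two elements -/
def Blk {J : Type*} {N : ℕ} (d : J → ZMod N) : Prop := ∀ s, ∃ t, t ≠ s ∧ RelD d s t

/-- some block has three elements -/
def Tri {J : Type*} {N : ℕ} (d : J → ZMod N) : Prop :=
  ∃ s t u, s ≠ t ∧ s ≠ u ∧ t ≠ u ∧ RelD d s t ∧ RelD d s u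

lemma reps_card {J : Type*} [Fintype J] [DecidableEq J] {N : ℕ} {d : J → ZMod N} (hb : Blk d)
    {f : J → J} (hf : ∀ s t, RelD d s t → f s = f t) :
    2 * (image f univ).card ≤ Fintype.card J := by
  rw [← Finset.card_univ]
  refine Finset.mul_card_image_le_card _ _ ?_
  intro a ha
  obtain ⟨s, -, rfl⟩ := mem_image.mp ha
  obtain ⟨t, hts, hr⟩ := hb s
  refine Nat.succ_le_of_lt (Finset.one_lt_card.mpr ⟨s, by simp, t, by simp [hf s t hr], hts.symm⟩)

lemma reps_card_tri {J : Type*} [Fintype J] [DecidableEq J] {N : ℕ} {d : J → ZMod N} (hb : Blk d)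
    (ht : Tri d) {f : J → J} (hf : ∀ s t, RelD d s t → f s = f t) :
    2 * (image f univ).card + 1 ≤ Fintype.card J := by
  obtain ⟨s, t, u, hst, hsu, htu, h1, h2⟩ := ht
  have him : image f univ = image f (univ.erase u) := by
    ext a
    simp only [mem_image, mem_univ, true_and, mem_erase]
    constructor
    · rintro ⟨x, rfl⟩
      by_cases hx : x = u
      · exact ⟨s, ⟨hsu, trivial⟩, by rw [hx, hf s u h2]⟩
      · exact ⟨x, ⟨hx, trivial⟩, rfl⟩
    · rintro ⟨x, _, rfl⟩; exact ⟨x, rfl⟩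
  have hc : (univ.erase u).card + 1 = Fintype.card J := by
    rw [Finset.card_erase_add_one (mem_univ _), Finset.card_univ]
  rw [him, ← hc]
  refine Nat.add_le_add_right (Finset.mul_card_image_le_card _ _ ?_) 1
  intro a ha
  obtain ⟨x, -, rfl⟩ := mem_image.mp ha
  by_cases hx : f x = f u
  · refine Nat.succ_le_of_lt (Finset.one_lt_card.mpr ⟨s, ?_, t, ?_, hst⟩)
    · simp [hsu, hx, hf s u h2]
    · simp [htu, hx, ← hf s u h2, hf s t h1]
  · obtain ⟨y, hyx, hr⟩ := hb x
    refine Nat.succ_le_of_lt (Finset.one_lt_card.mpr ⟨x, ?_, y, ?_, hyx.symm⟩)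
    · simp only [mem_filter, mem_erase, mem_univ, and_true]
      intro h; exact hx (by rw [h])
    · simp only [mem_filter, mem_erase, mem_univ, and_true]
      exact ⟨fun h => hx (by rw [hf x y hr, h]), (hf x y hr).symm⟩

/-- the special pair condition -/
def Spc {J : Type*} {N : ℕ} (S : Finset J) (d : J → ZMod N) : Prop :=
  ∑ s ∈ S, d s = 0 ∧ ∃ s t, s ≠ t ∧ RelD d s t ∧ (∀ u, RelD d s u → u = s ∨ u = t) ∧
    s ∈ S ∧ (t ∉ S ∨ d s = d t)

/-- the constant -/
def Cst (J : Type*) [Fintype J] [DecidableEq J] : ℕ :=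
  Fintype.card ((J → J) × (J → Bool)) + Fintype.card ((J → J) × (J → Bool) × J × Bool)

lemma count_D0 {J : Type*} [Fintype J] [DecidableEq J] {N : ℕ} [NeZero N]
    (D : Finset (J → ZMod N)) (h : ∀ d ∈ D, Blk d) :
    D.card ≤ Cst J * N ^ (Fintype.card J / 2) := by
  refine (count_A (Fintype.card J / 2) D ?_).trans
    (Nat.mul_le_mul_right _ (Nat.le_add_right _ _))
  intro d hd
  obtain ⟨f, hf, hf'⟩ := exists_reps d
  have := reps_card (h d hd) hf'
  exact ⟨f, hf, by omega⟩

lemma count_D {J : Type*} [Fintype J] [DecidableEq J] {N : ℕ} [NeZero N] (p : ℕ)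
    (hp : Fintype.card J = 2 * (p + 1)) (S : Finset J)
    (D : Finset (J → ZMod N)) (h : ∀ d ∈ D, Blk d ∧ (Tri d ∨ Spc S d)) :
    D.card ≤ Cst J * N ^ p := by
  classical
  rw [← Finset.card_filter_add_card_filter_not (s := D) Tri, Cst, add_mul]
  refine Nat.add_le_add ?_ ?_
  · refine count_A p _ ?_
    intro d hd
    obtain ⟨hd, ht⟩ := mem_filter.mp hd
    obtain ⟨f, hf, hf'⟩ := exists_reps d
    have := reps_card_tri (h d hd).1 ht hf'
    exact ⟨f, hf, by omega⟩
  · refine count_B p S _ ?_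
    intro d hd
    obtain ⟨hd, ht⟩ := mem_filter.mp hd
    obtain ⟨hb, hsp⟩ := h d hd
    obtain ⟨hS, s, t, hst, hr, hu, hs, hor⟩ := hsp.resolve_left ht
    obtain ⟨f, hf, hf'⟩ := exists_reps d
    have hcard := reps_card hb hf'
    refine ⟨hS, f, fun s => decide (d s = d (f s)), f s, fun s => RelD.sign hf s, ?_, ?_⟩
    · rw [Finset.card_erase_of_mem (mem_image_of_mem _ (mem_univ _))]; omega
    · have hfib : ∀ u, f u = f s ↔ u = s ∨ u = t := by
        intro u
        constructor
        · intro hfu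
          exact hu u ((hf s).trans (hfu ▸ (hf u).symm))
        · rintro (rfl | rfl)
          · rfl
          · exact (hf' _ _ hr).symm
      by_cases htS : t ∈ S
      · have hdst := hor.resolve_left (not_not.mpr htS)
        have hfs : S.filter (fun u => f u = f s) = {s, t} := by
          ext u
          simp only [mem_filter, mem_insert, mem_singleton, hfib]
          constructor
          · exact fun h => h.2
          · rintro (rfl | rfl)
            · exact ⟨hs, Or.inl rfl⟩
            · exact ⟨htS, Or.inr rfl⟩
        have e1 : d s = d (f s) := by
          rcases hu (f s) (hf s) with h | h
          · rw [h]
          · rw [h, hdst]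
        have e2 : d t = d (f t) := by rw [← hf' _ _ hr, ← e1, hdst]
        rw [hfs, Finset.sum_pair hst]
        simp [e1, ← e2]
      · have hfs : S.filter (fun u => f u = f s) = {s} := by
          ext u
          simp only [mem_filter, mem_singleton, hfib]
          constructor
          · rintro ⟨h, rfl | rfl⟩
            · rfl
            · exact absurd h htS
          · rintro rfl
            exact ⟨hs, Or.inl rfl⟩
        rw [hfs, Finset.sum_singleton]
        split_ifs <;> norm_num

lemma lift1 {n N : ℕ} [NeZero n] [NeZero N] (E : Finset (ZMod n → ZMod N)) :
    E.card ≤ N * (E.image df).card := by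
  classical
  have : E.card ≤ ((univ : Finset (ZMod N)) ×ˢ (E.image df)).card := by
    refine Finset.card_le_card_of_injOn (fun i => (i 0, df i)) ?_ ?_
    · intro i hi
      simp only [coe_product, coe_univ, coe_image, Set.mem_prod, Set.mem_univ, true_and]
      exact ⟨i, hi, rfl⟩
    · intro i _ i' _ h
      simp only [Prod.mk.injEq] at h
      exact df_inj i i' h.1 (fun s => congrFun h.2 s)
  simpa [Finset.card_product, ZMod.card] using this

lemma lift2 {n N : ℕ} [NeZero n] [NeZero N] (E : Finset ((ZMod n → ZMod N) × (ZMod n → ZMod N))) :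
    E.card ≤ N ^ 2 * (E.image (fun p => Sum.elim (df p.1) (df p.2))).card := by
  classical
  have : E.card ≤ ((univ : Finset (ZMod N × ZMod N)) ×ˢ
      (E.image (fun p => Sum.elim (df p.1) (df p.2)))).card := by
    refine Finset.card_le_card_of_injOn
      (fun i => ((i.1 0, i.2 0), Sum.elim (df i.1) (df i.2))) ?_ ?_
    · intro i hi
      simp only [coe_product, coe_univ, coe_image, Set.mem_prod, Set.mem_univ, true_and]
      exact ⟨i, hi, rfl⟩
    · intro i _ i' _ h
      simp only [Prod.mk.injEq] at h
      refine Prod.ext ?_ ?_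
      · exact df_inj _ _ h.1.1 (fun s => congrFun h.2 (Sum.inl s))
      · exact df_inj _ _ h.1.2 (fun s => congrFun h.2 (Sum.inr s))
  simpa [Finset.card_product, ZMod.card, sq] using this

lemma count1 (n : ℕ) [NeZero n] {N : ℕ} [NeZero N] (E : Finset (ZMod n → ZMod N))
    (h : ∀ i ∈ E, Blk (df i)) : E.card ≤ Cst (ZMod n) * N ^ (n / 2 + 1) := by
  classical
  refine (lift1 E).trans ?_
  have := count_D0 (E.image df) (by
    intro d hd; obtain ⟨i, hi, rfl⟩ := mem_image.mp hd; exact h i hi)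
  rw [ZMod.card] at this
  calc _ ≤ N * (Cst (ZMod n) * N ^ (n / 2)) := Nat.mul_le_mul_left _ this
    _ = _ := by ring

/-- non-generic circuits -/
def Bad {n N : ℕ} (i : ZMod n → ZMod N) : Prop :=
  Blk (df i) ∧ (Tri (df i) ∨ ∃ s t, s ≠ t ∧ df i s = df i t ∧
    ∀ u, RelD (df i) s u → u = s ∨ u = t)

lemma count2 (k : ℕ) (hk : 1 ≤ k) [NeZero (2 * k)] {N : ℕ} [NeZero N]
    (E : Finset (ZMod (2 * k) → ZMod N))
    (h : ∀ i ∈ E, Bad i) : E.card ≤ Cst (ZMod (2 * k)) * N ^ k := by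
  classical
  obtain ⟨p, rfl⟩ : ∃ p, k = p + 1 := ⟨k - 1, by omega⟩
  refine (lift1 E).trans ?_
  have := count_D p (by rw [ZMod.card]) univ (E.image df) (by
    intro d hd; obtain ⟨i, hi, rfl⟩ := mem_image.mp hd
    obtain ⟨h1, h2⟩ := h i hi
    refine ⟨h1, h2.imp_right ?_⟩
    rintro ⟨s, t, hst, he, hu⟩
    exact ⟨sum_df i, s, t, hst, Or.inl he, hu, mem_univ _, Or.inr he⟩)
  calc _ ≤ N * (Cst (ZMod (2 * (p+1))) * N ^ p) := Nat.mul_le_mul_left _ this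
    _ = _ := by ring

lemma count3 (n : ℕ) [NeZero n] {N : ℕ} [NeZero N]
    (E : Finset ((ZMod n → ZMod N) × (ZMod n → ZMod N)))
    (h : ∀ p ∈ E, Blk (Sum.elim (df p.1) (df p.2)) ∧
      ∃ s t, RelD (Sum.elim (df p.1) (df p.2)) (Sum.inl s) (Sum.inr t)) :
    E.card ≤ Cst (ZMod n ⊕ ZMod n) * N ^ (n + 1) := by
  classical
  obtain ⟨p, hp⟩ : ∃ p, n = p + 1 := ⟨n - 1, by have := NeZero.ne n; omega⟩
  refine (lift2 E).trans ?_
  have := count_D p (by rw [Fintype.card_sum, ZMod.card]; omega)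
    ((univ : Finset (ZMod n)).map Function.Embedding.inl)
    (E.image (fun p => Sum.elim (df p.1) (df p.2))) (by
    intro d hd; obtain ⟨i, hi, rfl⟩ := mem_image.mp hd
    obtain ⟨h1, s, t, hst⟩ := h i hi
    refine ⟨h1, ?_⟩
    by_cases ht : Tri (Sum.elim (df i.1) (df i.2))
    · exact Or.inl ht
    right
    refine ⟨?_, Sum.inl s, Sum.inr t, by simp, hst, ?_, by simp, by simp⟩
    · rw [Finset.sum_map]; simpa using sum_df i.1
    · intro u hu
      by_contra hcon
      push Not at hcon
      exact ht ⟨Sum.inl s, Sum.inr t, u, by simp, hcon.1.symm, hcon.2.symm, hst, hu⟩)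
  calc _ ≤ N ^ 2 * (Cst (ZMod n ⊕ ZMod n) * N ^ p) := Nat.mul_le_mul_left _ this
    _ = _ := by
      have hn : n + 1 = p + 2 := by omega
      rw [hn]; ring

end Count
end BC

namespace BC
open Finset

section Exact

/-- orientable constraint on differences -/
def HH {n : ℕ} {A : Type*} [AddCommGroup A] (σ : Equiv.Perm (ZMod n)) (i : ZMod n → A) : Prop :=
  ∀ s, i (s + 1) - i s = - (i (σ s + 1) - i (σ s))

/-- good circuits for a pairing -/
def GoodC {m N n : ℕ} (hm : m ∣ N) (σ : Equiv.Perm (ZMod n)) (i : ZMod n → ZMod N) : Prop :=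
  HH σ i ∧ ∀ s, ZMod.castHom hm (ZMod m) (i s) = ZMod.castHom hm (ZMod m) (i (σ s + 1))

lemma exists_of_df {A : Type*} [AddCommGroup A] {n : ℕ} [NeZero n] (δ : ZMod n → A)
    (hδ : ∑ s, δ s = 0) (a : A) : ∃ i : ZMod n → A, i 0 = a ∧ ∀ s, i (s + 1) - i s = δ s := by
  refine ⟨fun s => a + ∑ t ∈ range s.val, δ (t : ZMod n), by simp, fun s => ?_⟩
  have hs := ZMod.val_lt s
  have hcast : ((s.val : ℕ) : ZMod n) = s := by simp
  have hsum : ∑ t ∈ range n, δ (t : ZMod n) = 0 := by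
    rw [← hδ]
    refine Finset.sum_bij' (fun t _ => (t : ZMod n)) (fun s _ => s.val) ?_ ?_ ?_ ?_ ?_
    · simp
    · intro a _; simpa using ZMod.val_lt a
    · intro t ht; exact ZMod.val_cast_of_lt (by simpa using ht)
    · intro a _; simp
    · simp
  by_cases h : s.val + 1 < n
  · have hv : (s + 1).val = s.val + 1 := by
      rw [← hcast, ← Nat.cast_succ, ZMod.val_cast_of_lt h, hcast]
    simp only [hv, Finset.sum_range_succ, hcast]; abel
  · have hn : s.val + 1 = n := by omega
    have h0 : s + 1 = 0 := by
      rw [← hcast, ← Nat.cast_succ, Nat.succ_eq_add_one, hn]; simp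
    have hr : range n = range (s.val + 1) := by rw [hn]
    rw [hr, Finset.sum_range_succ, hcast] at hsum
    simp only [h0, ZMod.val_zero, Finset.sum_range_zero, eq_neg_of_add_eq_zero_right hsum]
    abel

/-- chosen representatives of the pairs -/
def RR {n : ℕ} [NeZero n] (σ : Equiv.Perm (ZMod n)) : Finset (ZMod n) :=
  univ.filter (fun s => s.val < (σ s).val)

lemma not_mem_RR {n : ℕ} [NeZero n] (σ : Pairing n) (s : ZMod n) :
    s ∉ RR σ.1 ↔ σ.1 s ∈ RR σ.1 := by
  simp only [RR, mem_filter, mem_univ, true_and, σ.2.1]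
  have : (σ.1 s).val ≠ s.val := fun h => σ.2.2 s (ZMod.val_injective n h)
  omega

lemma card_RR (k : ℕ) [NeZero (2 * k)] (σ : Pairing (2 * k)) : (RR σ.1).card = k := by
  classical
  have h1 : (RR σ.1)ᶜ = (RR σ.1).image σ.1 := by
    ext s
    rw [mem_compl, not_mem_RR, mem_image]
    constructor
    · intro h; exact ⟨_, h, σ.2.1 s⟩
    · rintro ⟨t, ht, rfl⟩; rwa [σ.2.1]
  have h2 := Finset.card_compl (RR σ.1)
  rw [h1, Finset.card_image_of_injective _ σ.1.injective, ZMod.card] at h2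
  have h3 := Finset.card_le_univ (RR σ.1)
  rw [ZMod.card] at h3
  omega

/-- coordinates of a circuit -/
def psi {n : ℕ} [NeZero n] {A : Type*} [AddCommGroup A] (σ : Equiv.Perm (ZMod n)) (i : ZMod n → A) :
    Option (RR σ) → A
  | none => i 0
  | some r => i (r.1 + 1) - i r.1

lemma psi_inj {n : ℕ} [NeZero n] {A : Type*} [AddCommGroup A] (σ : Pairing n)
    {i i' : ZMod n → A} (hi : HH σ.1 i) (hi' : HH σ.1 i') (h : psi σ.1 i = psi σ.1 i') : i = i' := by
  refine df_inj i i' (congrFun h none) fun s => ?_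
  by_cases hs : s ∈ RR σ.1
  · exact congrFun h (some ⟨s, hs⟩)
  · rw [hi, hi']
    exact congrArg Neg.neg (congrFun h (some ⟨σ.1 s, (not_mem_RR σ s).1 hs⟩))

lemma psi_surj {n : ℕ} [NeZero n] {A : Type*} [AddCommGroup A] (σ : Pairing n)
    (g : Option (RR σ.1) → A) : ∃ i : ZMod n → A, HH σ.1 i ∧ psi σ.1 i = g := by
  classical
  let δ : ZMod n → A := fun s => if h : s ∈ RR σ.1 then g (some ⟨s, h⟩) else
    - g (some ⟨σ.1 s, (not_mem_RR σ s).1 h⟩)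
  have hδ : ∀ s, δ (σ.1 s) = - δ s := by
    intro s
    by_cases hs : s ∈ RR σ.1
    · have h2 : σ.1 s ∉ RR σ.1 := fun h => (not_mem_RR σ s).2 h hs
      simp only [δ, dif_pos hs, dif_neg h2, σ.2.1]
    · have h2 := (not_mem_RR σ s).1 hs
      simp only [δ, dif_neg hs, dif_pos h2, neg_neg]
  have hsum : ∑ s, δ s = 0 := by
    have hsplit := Finset.sum_add_sum_compl (RR σ.1) δ
    have h1 : (RR σ.1)ᶜ = (RR σ.1).image σ.1 := by
      ext s
      rw [mem_compl, not_mem_RR, mem_image]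
      constructor
      · intro h; exact ⟨_, h, σ.2.1 s⟩
      · rintro ⟨t, ht, rfl⟩; rwa [σ.2.1]
    rw [← hsplit, h1, Finset.sum_image (fun _ _ _ _ h => σ.1.injective h)]
    simp [hδ]
  obtain ⟨i, h0, hi⟩ := exists_of_df δ hsum (g none)
  refine ⟨i, fun s => by rw [hi, hi, hδ, neg_neg], ?_⟩
  funext o
  rcases o with _ | r
  · exact h0
  · simp only [psi, hi, δ, dif_pos r.2]

open Classical in
lemma card_fiber {m N : ℕ} [NeZero N] [NeZero m] (hm : m ∣ N) (y : ZMod m) :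
    (univ.filter (fun x : ZMod N => ZMod.castHom hm (ZMod m) x = y)).card = N / m := by
  have hsurj : Function.Surjective (ZMod.castHom hm (ZMod m)) := ZMod.castHom_surjective hm
  have hconst : ∀ z, (univ.filter (fun x : ZMod N => ZMod.castHom hm (ZMod m) x = z)).card =
      (univ.filter (fun x : ZMod N => ZMod.castHom hm (ZMod m) x = y)).card := by
    intro z
    obtain ⟨a, ha⟩ := hsurj (y - z)
    refine Finset.card_bij' (fun x _ => x + a) (fun x _ => x - a) ?_ ?_ ?_ ?_
    · intro x hx
      simp only [mem_filter, mem_univ, true_and] at hx ⊢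
      rw [map_add, hx, ha]; ring
    · intro x hx
      simp only [mem_filter, mem_univ, true_and] at hx ⊢
      rw [map_sub, hx, ha]; ring
    · intro x _; ring
    · intro x _; ring
  have htot := Finset.card_eq_sum_card_fiberwise (s := (univ : Finset (ZMod N)))
    (f := ZMod.castHom hm (ZMod m)) (t := univ) (by simp)
  rw [Finset.sum_congr rfl (fun z _ => hconst z), Finset.sum_const, Finset.card_univ,
    Finset.card_univ, ZMod.card, ZMod.card, smul_eq_mul] at htot
  exact (Nat.div_eq_of_eq_mul_right (Nat.pos_of_ne_zero (NeZero.ne m)) htot).symm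

lemma HH_of_const {n : ℕ} {A : Type*} [AddCommGroup A] (σ : Pairing n) (w : ZMod n → A)
    (hw : ∀ s, w s = w (σ.1 s + 1)) : HH σ.1 w := by
  intro s
  rw [← hw s, hw (σ.1 s), σ.2.1]; abel

open Classical in
lemma card_lift {m N : ℕ} [NeZero N] [NeZero m] (hm : m ∣ N) (k : ℕ) [NeZero (2 * k)]
    (σ : Pairing (2 * k)) (w : ZMod (2 * k) → ZMod m) (hw : HH σ.1 w) :
    (univ.filter (fun i : ZMod (2 * k) → ZMod N => HH σ.1 i ∧
      (fun s => ZMod.castHom hm (ZMod m) (i s)) = w)).card = (N / m) ^ (k + 1) := by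
  have hnat : ∀ i : ZMod (2 * k) → ZMod N, ∀ o, ZMod.castHom hm (ZMod m) (psi σ.1 i o) =
      psi σ.1 (fun s => ZMod.castHom hm (ZMod m) (i s)) o := by
    intro i o
    rcases o with _ | r
    · rfl
    · simp only [psi, map_sub]
  have hHH : ∀ i : ZMod (2 * k) → ZMod N, HH σ.1 i →
      HH σ.1 (fun s => ZMod.castHom hm (ZMod m) (i s)) := by
    intro i hi s
    have := congrArg (ZMod.castHom hm (ZMod m)) (hi s)
    simpa only [map_sub, map_neg] using this
  have hT : (Fintype.piFinset (fun o : Option (RR σ.1) =>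
      univ.filter (fun x : ZMod N => ZMod.castHom hm (ZMod m) x = psi σ.1 w o))).card =
      (N / m) ^ (k + 1) := by
    rw [Fintype.card_piFinset]
    simp only [card_fiber]
    rw [Finset.prod_const, Finset.card_univ, Fintype.card_option, Fintype.card_coe, card_RR]
  rw [← hT]
  refine Finset.card_bij (fun i _ => psi σ.1 i) ?_ ?_ ?_
  · intro i hi
    simp only [mem_filter, mem_univ, true_and] at hi
    simp only [Fintype.mem_piFinset, mem_filter, mem_univ, true_and]
    intro o
    rw [hnat, hi.2]
  · intro i hi i' hi' h
    simp only [mem_filter, mem_univ, true_and] at hi hi'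
    exact psi_inj σ hi.1 hi'.1 h
  · intro g hg
    simp only [Fintype.mem_piFinset, mem_filter, mem_univ, true_and] at hg
    obtain ⟨i, hi, rfl⟩ := psi_surj σ g
    refine ⟨i, ?_, rfl⟩
    simp only [mem_filter, mem_univ, true_and]
    refine ⟨hi, psi_inj σ (hHH i hi) hw ?_⟩
    funext o
    rw [← hnat, hg]

open Classical in
lemma card_W {m : ℕ} [NeZero m] (n : ℕ) [NeZero n] (σ : Equiv.Perm (ZMod n)) :
    (univ.filter (fun w : ZMod n → ZMod m => ∀ s, w s = w (σ s + 1))).card = m ^ vfun n σ := by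
  have e : {w : ZMod n → ZMod m // ∀ s, w s = w (σ s + 1)} ≃
      (Quot (fun a b : ZMod n => b = σ a + 1) → ZMod m) :=
    { toFun := fun w => Quot.lift w.1 (fun a b h => by rw [h]; exact w.2 a)
      invFun := fun g => ⟨fun s => g (Quot.mk _ s), fun s => congrArg g (Quot.sound rfl)⟩
      left_inv := fun w => rfl
      right_inv := fun g => by funext q; induction q using Quot.ind; rfl }
  have : Finite (Quot (fun a b : ZMod n => b = σ a + 1)) :=
    Finite.of_surjective _ (fun q => Quot.exists_rep q)
  rw [← Fintype.card_subtype, ← Nat.card_eq_fintype_card, Nat.card_congr e, Nat.card_fun,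
    Nat.card_zmod, vfun]

open Classical in
lemma card_GoodC {m N : ℕ} [NeZero N] [NeZero m] (hm : m ∣ N) (k : ℕ) [NeZero (2 * k)]
    (σ : Pairing (2 * k)) :
    (univ.filter (fun i : ZMod (2 * k) → ZMod N => GoodC hm σ.1 i)).card =
      m ^ vfun (2 * k) σ.1 * (N / m) ^ (k + 1) := by
  rw [Finset.card_eq_sum_card_fiberwise (f := fun i s => ZMod.castHom hm (ZMod m) (i s))
    (t := univ.filter (fun w : ZMod (2 * k) → ZMod m => ∀ s, w s = w (σ.1 s + 1)))]
  · rw [← card_W (2 * k) σ.1]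
    refine Finset.sum_const_nat fun w hw => ?_
    simp only [mem_filter, mem_univ, true_and] at hw
    rw [← card_lift hm k σ w (HH_of_const σ w hw)]
    congr 1
    ext i
    simp only [mem_filter, mem_univ, true_and]
    constructor
    · rintro ⟨⟨h1, _⟩, h3⟩; exact ⟨h1, h3⟩
    · rintro ⟨h1, h3⟩
      refine ⟨⟨h1, fun s => ?_⟩, h3⟩
      have := hw s
      rw [← h3] at this
      exact this
  · intro i hi
    simp only [coe_filter, mem_univ, true_and, Set.mem_ofPred_eq] at hi ⊢
    exact hi.2

open Classical in
lemma card_GoodC_real {m N : ℕ} [NeZero N] [NeZero m] (hm : m ∣ N) (k : ℕ) [NeZero (2 * k)]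
    (σ : Pairing (2 * k)) :
    ((N : ℝ) ^ (k + 1))⁻¹ *
      ((univ.filter (fun i : ZMod (2 * k) → ZMod N => GoodC hm σ.1 i)).card : ℝ) =
      (m : ℝ) ^ ((vfun (2 * k) σ.1 : ℤ) - (k + 1 : ℤ)) := by
  rw [card_GoodC]
  have hm0 : (m : ℝ) ≠ 0 := Nat.cast_ne_zero.mpr (NeZero.ne m)
  have hN0 : (N : ℝ) ≠ 0 := Nat.cast_ne_zero.mpr (NeZero.ne N)
  rw [zpow_sub₀ hm0]
  push_cast [Nat.cast_div hm hm0]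
  have : (m : ℝ) ^ ((k : ℤ) + 1) = (m : ℝ) ^ (k + 1) := by
    exact_mod_cast zpow_natCast (m : ℝ) (k + 1)
  rw [this, zpow_natCast, div_pow]
  field_simp

end Exact
end BC

namespace BC
open Finset

section Assembly

lemma cw_rel {m N : ℕ} (hm : m ∣ N) {n : ℕ} {i : ZMod n → ZMod N} {s t : ZMod n}
    (h : cw hm i s = cw hm i t) : RelD (df i) s t := by
  rcases (cw_eq hm i i s t).1 h with h | h
  · exact Or.inl h.1
  · exact Or.inr h.1

lemma Good_cw {m N : ℕ} (hm : m ∣ N) {n : ℕ} {i : ZMod n → ZMod N} {σ : Equiv.Perm (ZMod n)}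
    (h : GoodC hm σ i) (s : ZMod n) : cw hm i s = cw hm i (σ s) :=
  (cw_eq hm i i s (σ s)).2 (Or.inr ⟨h.1 s, h.2 s⟩)

open Classical in
lemma term_eq (μ : Measure ℝ) [IsProbabilityMeasure μ]
    (hmean : ∫ x : ℝ, x ∂μ = 0) (hvar : ∫ x : ℝ, x ^ 2 ∂μ = 1)
    {m N n : ℕ} [NeZero n] (hm : m ∣ N) [Fintype (BCidx m N hm)] (i : ZMod n → ZMod N)
    (hbad : ¬ Bad i) :
    Fm μ (cw hm i) = ∑ σ : Pairing n, if GoodC hm σ.1 i then (1 : ℝ) else 0 := by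
  by_cases hall : ∀ s, ∃ t, t ≠ s ∧ cw hm i t = cw hm i s
  · have hblk : Blk (df i) := fun s => by
      obtain ⟨t, h1, h2⟩ := hall s
      exact ⟨t, h1, (cw_rel hm h2).symm⟩
    have htri : ¬ Tri (df i) := fun h => hbad ⟨hblk, Or.inl h⟩
    have hsp : ¬ ∃ s t, s ≠ t ∧ df i s = df i t ∧ ∀ u, RelD (df i) s u → u = s ∨ u = t :=
      fun h => hbad ⟨hblk, Or.inr h⟩
    choose f hf1 hf2 using hall
    have hfr : ∀ s, RelD (df i) s (f s) := fun s => (cw_rel hm (hf2 s)).symm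
    have huniq : ∀ s u, RelD (df i) s u → u = s ∨ u = f s := by
      intro s u hu
      by_contra hcon
      push Not at hcon
      exact htri ⟨s, f s, u, (hf1 s).symm, hcon.1.symm, hcon.2.symm, hfr s, hu⟩
    have hinv : Function.Involutive f := by
      intro s
      rcases huniq s (f (f s)) ((hfr s).trans (hfr (f s))) with h | h
      · exact h
      · exact absurd h (hf1 (f s))
    let σ0 : Pairing n := ⟨hinv.toPerm f, fun j => hinv j, fun j => hf1 j⟩
    have hgood : GoodC hm σ0.1 i := by
      have key : ∀ s, df i s = - df i (f s) ∧ ZMod.castHom hm (ZMod m) (i s) =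
          ZMod.castHom hm (ZMod m) (i (f s + 1)) := by
        intro s
        rcases (cw_eq hm i i s (f s)).1 (hf2 s).symm with h | h
        · exact absurd ⟨s, f s, (hf1 s).symm, h.1, huniq s⟩ hsp
        · exact h
      exact ⟨fun s => (key s).1, fun s => (key s).2⟩
    rw [Finset.sum_eq_single σ0, if_pos hgood]
    · refine Fm_one μ hvar _ fun s => ⟨f s, hf1 s, fun u => ⟨fun h => ?_, ?_⟩⟩
      · exact huniq s u (cw_rel hm h).symm
      · rintro (rfl | rfl)
        · rfl
        · exact hf2 s
    · intro σ _ hσ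
      rw [if_neg]
      intro hg
      apply hσ
      apply Subtype.ext
      apply Equiv.ext
      intro s
      rcases huniq s (σ.1 s) (cw_rel hm (Good_cw hm hg s)) with h | h
      · exact absurd h (σ.2.2 s)
      · exact h
    · intro h; exact absurd (mem_univ _) h
  · push Not at hall
    obtain ⟨s, hs⟩ := hall
    rw [Fm_zero μ hmean (cw hm i) s (fun t ht => by
      by_contra h; exact hs t h ht)]
    symm
    refine Finset.sum_eq_zero fun σ _ => ?_
    rw [if_neg]
    intro hg
    exact hs (σ.1 s) (σ.2.2 s) (Good_cw hm hg s).symm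

open Classical in
lemma sum_bound {I : Type*} [Fintype I] (g : I → ℝ) (P : I → Prop) (K : ℝ) (B : ℝ) (hK : 0 ≤ K)
    (h0 : ∀ i, ¬ P i → g i = 0) (h1 : ∀ i, |g i| ≤ K)
    (hB : ((univ.filter P).card : ℝ) ≤ B) : |∑ i, g i| ≤ K * B := by
  have : ∑ i, g i = ∑ i ∈ univ.filter P, g i := by
    symm
    refine Finset.sum_subset (filter_subset _ _) fun i _ hi => h0 i ?_
    simpa using hi
  rw [this]
  calc |∑ i ∈ univ.filter P, g i| ≤ ∑ i ∈ univ.filter P, |g i| := Finset.abs_sum_le_sum_abs _ _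
    _ ≤ ∑ i ∈ univ.filter P, K := Finset.sum_le_sum fun i _ => h1 i
    _ = ((univ.filter P).card : ℝ) * K := by rw [Finset.sum_const, nsmul_eq_mul]
    _ ≤ _ := by rw [mul_comm]; exact mul_le_mul_of_nonneg_left hB hK

lemma mean_even (μ : Measure ℝ) [IsProbabilityMeasure μ]
    (hmean : ∫ x : ℝ, x ∂μ = 0) (hvar : ∫ x : ℝ, x ^ 2 ∂μ = 1) (k : ℕ) (hk : 1 ≤ k)
    [NeZero (2 * k)] :
    ∃ C : ℝ, 0 ≤ C ∧ ∀ (m N : ℕ) [NeZero N] [NeZero m] (hm : m ∣ N) [Fintype (BCidx m N hm)],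
      |((N : ℝ) ^ (k + 1))⁻¹ * (∑ i : ZMod (2 * k) → ZMod N, Fm μ (cw hm i)) -
        ∑ σ : Pairing (2 * k), (m : ℝ) ^ ((vfun (2 * k) σ.1 : ℤ) - (k + 1 : ℤ))| ≤ C / N := by
  classical
  obtain ⟨K, hK1, hK⟩ := exists_bound μ (2 * k)
  refine ⟨(K ^ (2 * k) + Fintype.card (Pairing (2 * k))) * Cst (ZMod (2 * k)), by positivity, ?_⟩
  intro m N _ _ hm _
  have hN0 : (N : ℝ) ≠ 0 := Nat.cast_ne_zero.mpr (NeZero.ne N)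
  have hNpos : (0 : ℝ) < N := by positivity
  have hL : ∑ σ : Pairing (2 * k), (m : ℝ) ^ ((vfun (2 * k) σ.1 : ℤ) - (k + 1 : ℤ)) =
      ((N : ℝ) ^ (k + 1))⁻¹ * ∑ i : ZMod (2 * k) → ZMod N, ∑ σ : Pairing (2 * k),
        (if GoodC hm σ.1 i then (1 : ℝ) else 0) := by
    rw [Finset.sum_comm, Finset.mul_sum]
    refine Finset.sum_congr rfl fun σ _ => ?_
    rw [← card_GoodC_real hm k σ, Finset.sum_boole]
  rw [hL, ← mul_sub, ← Finset.sum_sub_distrib, abs_mul, abs_of_nonneg (by positivity)]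
  have hb := sum_bound (fun i : ZMod (2 * k) → ZMod N => Fm μ (cw hm i) -
    ∑ σ : Pairing (2 * k), (if GoodC hm σ.1 i then (1 : ℝ) else 0)) Bad
    (K ^ (2 * k) + Fintype.card (Pairing (2 * k))) (Cst (ZMod (2 * k)) * (N : ℝ) ^ k)
    (by positivity) (fun i hi => by rw [term_eq μ hmean hvar hm i hi, sub_self])
    (fun i => by
      refine (abs_sub _ _).trans (add_le_add ?_ ?_)
      · have := Fm_bound μ (cw hm i) K (by rw [ZMod.card]; exact hK)
        rwa [ZMod.card] at this
      · rw [Finset.sum_boole, abs_of_nonneg (by positivity)]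
        exact_mod_cast Finset.card_le_univ _)
    (by exact_mod_cast count2 k hk _ (fun i hi => (mem_filter.mp hi).2))
  calc _ ≤ ((N : ℝ) ^ (k + 1))⁻¹ * ((K ^ (2 * k) + Fintype.card (Pairing (2 * k))) *
        (Cst (ZMod (2 * k)) * (N : ℝ) ^ k)) := mul_le_mul_of_nonneg_left hb (by positivity)
    _ = _ := by
      field_simp
      ring

lemma mean_odd (μ : Measure ℝ) [IsProbabilityMeasure μ]
    (hmean : ∫ x : ℝ, x ∂μ = 0) (k : ℕ) :
    ∃ C : ℝ, 0 ≤ C ∧ ∀ (m N : ℕ) [NeZero N] [NeZero m] (hm : m ∣ N) [Fintype (BCidx m N hm)],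
      |∑ i : ZMod (2 * k + 1) → ZMod N, Fm μ (cw hm i)| ≤ C * (N : ℝ) ^ (k + 1) := by
  classical
  obtain ⟨K, hK1, hK⟩ := exists_bound μ (2 * k + 1)
  refine ⟨K ^ (2 * k + 1) * Cst (ZMod (2 * k + 1)), by positivity, ?_⟩
  intro m N _ _ hm _
  have hb := sum_bound (fun i : ZMod (2 * k + 1) → ZMod N => Fm μ (cw hm i)) (fun i => Blk (df i))
    (K ^ (2 * k + 1)) (Cst (ZMod (2 * k + 1)) * (N : ℝ) ^ (k + 1))
    (by positivity) (fun i hi => by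
      unfold Blk at hi
      push Not at hi
      obtain ⟨s, hs⟩ := hi
      refine Fm_zero μ hmean _ s fun t ht => ?_
      by_contra hts
      exact hs t hts (cw_rel hm ht).symm)
    (fun i => by
      have := Fm_bound μ (cw hm i) K (by rw [ZMod.card]; exact hK)
      rwa [ZMod.card] at this)
    (by
      have := count1 (2 * k + 1) (univ.filter (fun i : ZMod (2 * k + 1) → ZMod N => Blk (df i)))
        (fun i hi => (mem_filter.mp hi).2)
      rw [show (2 * k + 1) / 2 = k by omega] at this
      exact_mod_cast this)
  rw [mul_assoc]
  exact hb

lemma cov_zero (μ : Measure ℝ) [IsProbabilityMeasure μ] (hmean : ∫ x : ℝ, x ∂μ = 0)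
    {m N n : ℕ} [NeZero n] (hm : m ∣ N) [Fintype (BCidx m N hm)] (i i' : ZMod n → ZMod N)
    (h : ¬ (Blk (Sum.elim (df i) (df i')) ∧
      ∃ s t, RelD (Sum.elim (df i) (df i')) (Sum.inl s) (Sum.inr t))) :
    Fm μ (Sum.elim (cw hm i) (cw hm i')) - Fm μ (cw hm i) * Fm μ (cw hm i') = 0 := by
  have hrel : ∀ a b, Sum.elim (cw hm i) (cw hm i') a = Sum.elim (cw hm i) (cw hm i') b →
      RelD (Sum.elim (df i) (df i')) a b := by
    rintro (a | a) (b | b) hab <;> simp only [Sum.elim_inl, Sum.elim_inr, RelD] at hab ⊢ <;>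
    rcases (cw_eq hm _ _ _ _).1 hab with h | h <;> simp [h.1]
  by_cases hsh : ∀ s t, cw hm i s ≠ cw hm i' t
  · rw [Fm_mul μ _ _ hsh, sub_self]
  · push Not at hsh
    obtain ⟨s, t, hst⟩ := hsh
    have hnb : ¬ Blk (Sum.elim (df i) (df i')) := fun hb =>
      h ⟨hb, s, t, hrel (Sum.inl s) (Sum.inr t) hst⟩
    unfold Blk at hnb
    push Not at hnb
    obtain ⟨a, ha⟩ := hnb
    have hsing : ∀ b, Sum.elim (cw hm i) (cw hm i') b = Sum.elim (cw hm i) (cw hm i') a → b = a := by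
      intro b hb
      by_contra hba
      exact ha b hba (hrel _ _ hb).symm
    rw [Fm_zero μ hmean _ a hsing]
    rcases a with a | a
    · rw [Fm_zero μ hmean (cw hm i) a fun b hb => Sum.inl_injective (hsing (Sum.inl b) hb)]; simp
    · rw [Fm_zero μ hmean (cw hm i') a fun b hb => Sum.inr_injective (hsing (Sum.inr b) hb)]; simp

lemma var_bound (μ : Measure ℝ) [IsProbabilityMeasure μ]
    (hmean : ∫ x : ℝ, x ∂μ = 0) (n : ℕ) [NeZero n] :
    ∃ C : ℝ, 0 ≤ C ∧ ∀ (m N : ℕ) [NeZero N] [NeZero m] (hm : m ∣ N) [Fintype (BCidx m N hm)],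
      ∑ i : ZMod n → ZMod N, ∑ i' : ZMod n → ZMod N,
        (Fm μ (Sum.elim (cw hm i) (cw hm i')) - Fm μ (cw hm i) * Fm μ (cw hm i')) ≤
        C * (N : ℝ) ^ (n + 1) := by
  classical
  obtain ⟨K, hK1, hK⟩ := exists_bound μ (2 * n)
  refine ⟨(K ^ (2 * n) + K ^ n * K ^ n) * Cst (ZMod n ⊕ ZMod n), by positivity, ?_⟩
  intro m N _ _ hm _
  have hF : ∀ i : ZMod n → ZMod N, |Fm μ (cw hm i)| ≤ K ^ n := by
    intro i
    have := Fm_bound μ (cw hm i) K (by rw [ZMod.card]; exact fun a ha => hK a (by omega))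
    rwa [ZMod.card] at this
  have hb := sum_bound (fun p : (ZMod n → ZMod N) × (ZMod n → ZMod N) =>
      Fm μ (Sum.elim (cw hm p.1) (cw hm p.2)) - Fm μ (cw hm p.1) * Fm μ (cw hm p.2))
    (fun p => Blk (Sum.elim (df p.1) (df p.2)) ∧
      ∃ s t, RelD (Sum.elim (df p.1) (df p.2)) (Sum.inl s) (Sum.inr t))
    (K ^ (2 * n) + K ^ n * K ^ n) (Cst (ZMod n ⊕ ZMod n) * (N : ℝ) ^ (n + 1))
    (by positivity) (fun p hp => cov_zero μ hmean hm p.1 p.2 hp)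
    (fun p => by
      refine (abs_sub _ _).trans (add_le_add ?_ ?_)
      · have hc : Fintype.card (ZMod n ⊕ ZMod n) = 2 * n := by
          rw [Fintype.card_sum, ZMod.card]; omega
        have := Fm_bound μ (Sum.elim (cw hm p.1) (cw hm p.2)) K (by rw [hc]; exact hK)
        rwa [hc] at this
      · rw [abs_mul]
        exact mul_le_mul (hF _) (hF _) (abs_nonneg _) (by positivity))
    (by
      have := count3 n (univ.filter (fun p : (ZMod n → ZMod N) × (ZMod n → ZMod N) =>
        Blk (Sum.elim (df p.1) (df p.2)) ∧
          ∃ s t, RelD (Sum.elim (df p.1) (df p.2)) (Sum.inl s) (Sum.inr t)))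
        (fun p hp => (mem_filter.mp hp).2)
      have h' := (Nat.cast_le (α := ℝ)).mpr this
      push_cast at h'
      refine le_trans (le_of_eq ?_) h'
      congr!)
  rw [Fintype.sum_prod_type] at hb
  rw [mul_assoc]
  exact (le_abs_self _).trans hb

lemma prob_even (μ : Measure ℝ) [IsProbabilityMeasure μ]
    (hmean : ∫ x : ℝ, x ∂μ = 0) (hvar : ∫ x : ℝ, x ^ 2 ∂μ = 1)
    (hmom : ∀ n : ℕ, Integrable (fun x : ℝ => x ^ n) μ) (k : ℕ) (hk : 1 ≤ k)
    [NeZero (2 * k)] (ε : ℝ) (hε : 0 < ε) :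
    ∃ C : ℝ, ∀ (m N : ℕ) (hm : m ∣ N) (hN : N ≠ 0),
      probMat μ m N hm hN (fun M => ε <
            |((N : ℝ) ^ (k + 1))⁻¹ * Matrix.trace (M ^ (2 * k)) -
              ∑ σ : Pairing (2 * k), (m : ℝ) ^ ((vfun (2 * k) σ.1 : ℤ) - (k + 1 : ℤ))|) ≤
        ENNReal.ofReal (C / N) := by
  obtain ⟨C1, hC1, h1⟩ := mean_even μ hmean hvar k hk
  obtain ⟨C2, hC2, h2⟩ := var_bound μ hmean (2 * k)
  refine ⟨(C2 + C1 ^ 2) / ε ^ 2, fun m N hm hN => ?_⟩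
  unfold probMat
  have i1 : NeZero N := ⟨hN⟩
  have i2 : NeZero m := ⟨by rintro rfl; exact hN (zero_dvd_iff.mp hm)⟩
  have i3 : Finite (BCidx m N hm) := Finite.of_surjective _ (fun q => Quot.exists_rep q)
  letI i4 : Fintype (BCidx m N hm) := Fintype.ofFinite _
  simp only [trace_BC]
  refine (prob_bound μ hmom _ _ _ ε hε).trans (ENNReal.ofReal_le_ofReal ?_)
  have hN1 : (1 : ℝ) ≤ N := by exact_mod_cast Nat.pos_of_ne_zero hN
  have hN0 : (0 : ℝ) < N := by linarith
  rw [div_right_comm]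
  refine div_le_div_of_nonneg_right ?_ (by positivity)
  rw [add_div]
  refine add_le_add ?_ ?_
  · refine (mul_le_mul_of_nonneg_left (h2 m N hm) (by positivity)).trans (le_of_eq ?_)
    field_simp
    ring
  · have := h1 m N hm
    rw [← sq_abs]
    refine (pow_le_pow_left₀ (abs_nonneg _) this 2).trans ?_
    rw [div_pow]
    refine div_le_div_of_nonneg_left (by positivity) hN0 ?_
    nlinarith

lemma prob_odd (μ : Measure ℝ) [IsProbabilityMeasure μ]
    (hmean : ∫ x : ℝ, x ∂μ = 0)
    (hmom : ∀ n : ℕ, Integrable (fun x : ℝ => x ^ n) μ) (k : ℕ) (ε : ℝ) (hε : 0 < ε) :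
    ∃ C : ℝ, ∀ (m N : ℕ) (hm : m ∣ N) (hN : N ≠ 0),
      probMat μ m N hm hN (fun M => ε <
            (Real.sqrt (N : ℝ) * (N : ℝ) ^ (k + 1))⁻¹ * |Matrix.trace (M ^ (2 * k + 1))|) ≤
        ENNReal.ofReal (C / N) := by
  obtain ⟨C1, hC1, h1⟩ := mean_odd μ hmean k
  obtain ⟨C2, hC2, h2⟩ := var_bound μ hmean (2 * k + 1)
  refine ⟨(C2 + C1 ^ 2) / ε ^ 2, fun m N hm hN => ?_⟩
  unfold probMat
  have i1 : NeZero N := ⟨hN⟩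
  have i2 : NeZero m := ⟨by rintro rfl; exact hN (zero_dvd_iff.mp hm)⟩
  have i3 : Finite (BCidx m N hm) := Finite.of_surjective _ (fun q => Quot.exists_rep q)
  letI i4 : Fintype (BCidx m N hm) := Fintype.ofFinite _
  have hN1 : (1 : ℝ) ≤ N := by exact_mod_cast Nat.pos_of_ne_zero hN
  have hN0 : (0 : ℝ) < N := by linarith
  have hw : ∀ y : ℝ, (Real.sqrt (N : ℝ) * (N : ℝ) ^ (k + 1))⁻¹ * |y| =
      |(Real.sqrt (N : ℝ) * (N : ℝ) ^ (k + 1))⁻¹ * y - 0| := by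
    intro y
    rw [sub_zero, abs_mul, abs_of_nonneg (a := (Real.sqrt (N : ℝ) * (N : ℝ) ^ (k + 1))⁻¹)
      (by positivity)]
  have hw2 : ((Real.sqrt (N : ℝ) * (N : ℝ) ^ (k + 1))⁻¹) ^ 2 = ((N : ℝ) ^ (2 * k + 3))⁻¹ := by
    rw [inv_pow, mul_pow, Real.sq_sqrt hN0.le]
    congr 1
    ring
  simp only [hw, trace_BC]
  refine (prob_bound μ hmom _ _ _ ε hε).trans (ENNReal.ofReal_le_ofReal ?_)
  rw [div_right_comm]
  refine div_le_div_of_nonneg_right ?_ (by positivity)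
  rw [add_div, sub_zero, mul_pow, hw2]
  refine add_le_add ?_ ?_
  · refine (mul_le_mul_of_nonneg_left (h2 m N hm) (by positivity)).trans (le_of_eq ?_)
    field_simp
    ring
  · have := h1 m N hm
    rw [← sq_abs (∑ i, _)]
    refine (mul_le_mul_of_nonneg_left (pow_le_pow_left₀ (abs_nonneg _) this 2)
      (by positivity)).trans (le_of_eq ?_)
    field_simp
    ring

lemma tendsto_bound (m : ℕ) (hm : 1 ≤ m) (C : ℝ) :
    Tendsto (fun j : ℕ => ENNReal.ofReal (C / ((m * (j + 1) : ℕ) : ℝ))) atTop (nhds 0) := by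
  rw [← ENNReal.ofReal_zero]
  refine ENNReal.tendsto_ofReal ?_
  refine Tendsto.div_atTop tendsto_const_nhds ?_
  refine tendsto_natCast_atTop_atTop.comp ?_
  refine tendsto_atTop_mono (fun j => ?_) tendsto_id
  simp only [id]
  nlinarith

end Assembly
end BC

/-- the moments of the empirical spectral measures converge in probability to
the limiting moments: for every `ε > 0` the probability of an `ε` deviation of the normalized
even (resp. odd) trace moments from `∑_σ m^{-(k+1-v(σ))}` (resp. `0`) tends to `0`. -/
theorem moments_converge_in_probability
    (μ : Measure ℝ) [IsProbabilityMeasure μ]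
    (hmean : ∫ x : ℝ, x ∂μ = 0) (hvar : ∫ x : ℝ, x ^ 2 ∂μ = 1)
    (hmom : ∀ n : ℕ, Integrable (fun x : ℝ => x ^ n) μ)
    (m k : ℕ) (hm : 1 ≤ m) (hk : 1 ≤ k) (ε : ℝ) (hε : 0 < ε) :
    haveI : NeZero (2 * k) := ⟨by omega⟩
    Tendsto
      (fun j : ℕ =>
        probMat μ m (m * (j + 1)) (dvd_mul_right m (j + 1))
          (Nat.mul_ne_zero (by omega) (by omega))
          (fun M => ε <
            |(((m * (j + 1) : ℕ) : ℝ) ^ (k + 1))⁻¹ * Matrix.trace (M ^ (2 * k)) -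
              ∑ σ : Pairing (2 * k), (m : ℝ) ^ ((vfun (2 * k) σ.1 : ℤ) - (k + 1 : ℤ))|))
      atTop (nhds 0) ∧
    Tendsto
      (fun j : ℕ =>
        probMat μ m (m * (j + 1)) (dvd_mul_right m (j + 1))
          (Nat.mul_ne_zero (by omega) (by omega))
          (fun M => ε <
            (Real.sqrt ((m * (j + 1) : ℕ)) * ((m * (j + 1) : ℕ) : ℝ) ^ (k + 1))⁻¹ *
              |Matrix.trace (M ^ (2 * k + 1))|))
      atTop (nhds 0) := by
  constructor
  · obtain ⟨C, hC⟩ := @BC.prob_even μ _ hmean hvar hmom k hk ⟨by omega⟩ ε hε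
    exact tendsto_of_tendsto_of_tendsto_of_le_of_le tendsto_const_nhds (BC.tendsto_bound m hm C)
      (fun _ => zero_le) (fun j => hC m (m * (j + 1)) _ _)
  · obtain ⟨C, hC⟩ := BC.prob_odd μ hmean hmom k ε hε
    exact tendsto_of_tendsto_of_tendsto_of_le_of_le tendsto_const_nhds (BC.tendsto_bound m hm C)
      (fun _ => zero_le) (fun j => hC m (m * (j + 1)) _ _)
end
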